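/- arXiv:math/0703892 — 2 statements merged into one kernel-verified Lean document; each statement's English description precedes it below -/
import Mathlib

section
/- There exists a compact subset X of ℝ² such that the collection of connected components of X that are infinite sets is countably infinite, and such that, for 𝕂 = ℝ or ℂ, C(X;𝕂) admits an isometric shift which is of type I, non-primitive, and ∞-generated (hence of type I₀). -/
open Topology

open Topology

/-- `T` is an isometric shift: an isometry whose range has codimension 1 and with
`⋂_{n≥1} Tⁿ(E) = {0}`. -/
def IsIsometricShift {𝕜 E : Type*} [RCLike 𝕜] [NormedAddCommGroup E] [NormedSpace 𝕜 E]
    (T : E →L[𝕜] E) : Prop :=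
  (∀ f, ‖T f‖ = ‖f‖) ∧
    Module.rank 𝕜 (E ⧸ LinearMap.range (T : E →ₗ[𝕜] E)) = 1 ∧
    (⋂ n : ℕ, Set.range ((⇑T)^[n + 1])) = {0}

/-- A witness that `T` is an isometric shift of type I: an isolated point `p`, a
homeomorphism `φ : X∖{p} ≃ₜ X` and a unimodular weight `a` with `T f x = a x * f (φ x)`. -/
structure TypeIWitness {X : Type*} [TopologicalSpace X] [CompactSpace X]
    {𝕜 : Type*} [RCLike 𝕜] (T : C(X, 𝕜) →L[𝕜] C(X, 𝕜)) where
  p : X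
  isolated : IsOpen ({p} : Set X)
  φ : {x : X // x ≠ p} ≃ₜ X
  a : C({x : X // x ≠ p}, 𝕜)
  norm_a : ∀ x, ‖a x‖ = 1
  hT : ∀ (f : C(X, 𝕜)) (x : {x : X // x ≠ p}), T f x.1 = a x * f (φ x)

/-- `T` is an isometric shift of type I. -/
def IsTypeI {X : Type*} [TopologicalSpace X] [CompactSpace X]
    {𝕜 : Type*} [RCLike 𝕜] (T : C(X, 𝕜) →L[𝕜] C(X, 𝕜)) : Prop :=
  Nonempty (TypeIWitness T)

/-- `T` is an isometric shift of type II. -/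
def IsTypeII {X : Type*} [TopologicalSpace X] [CompactSpace X]
    {𝕜 : Type*} [RCLike 𝕜] (T : C(X, 𝕜) →L[𝕜] C(X, 𝕜)) : Prop :=
  ∃ (ψ : C(X, X)) (b : C(X, 𝕜)), Function.Surjective ψ ∧ (∀ x, ‖b x‖ = 1) ∧
    ∀ (f : C(X, 𝕜)) (x : X), T f x = b x * f (ψ x)

namespace TypeIWitness

variable {X : Type*} [TopologicalSpace X] [CompactSpace X] {𝕜 : Type*} [RCLike 𝕜]
  {T : C(X, 𝕜) →L[𝕜] C(X, 𝕜)}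

/-- The sequence `𝐧₁ = p`, `𝐧_{k+1} = φ⁻¹(𝐧_k)` (0-indexed: `nseq 0 = p`). -/
def nseq (w : TypeIWitness T) : ℕ → X
  | 0 => w.p
  | k + 1 => (w.φ.symm (nseq w k)).1

/-- The set `𝒩 = {𝐧_k : k ∈ ℕ}`. -/
def NSet (w : TypeIWitness T) : Set X :=
  Set.range w.nseq

/-- `T` (with witness `w`) is non-primitive when `𝒩` is not dense. -/
def NonPrimitive (w : TypeIWitness T) : Prop :=
  closure w.NSet ≠ Set.univ

open Classical in
/-- Forward iteration map associated to `φ` (defined arbitrarily at `p`). -/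
noncomputable def fwd (w : TypeIWitness T) : X → X :=
  fun x => if h : x = w.p then w.p else w.φ ⟨x, h⟩

/-- Backward iteration map associated to `φ`. -/
def bwd (w : TypeIWitness T) : X → X :=
  fun x => (w.φ.symm x).1

/-- The full orbit `{φ^k(x) : k ∈ ℤ}` of a point `x` (for points outside `cl 𝒩`,
where all iterates are genuinely defined). -/
def orbit (w : TypeIWitness T) (x : X) : Set X :=
  (Set.range fun k : ℕ => w.fwd^[k] x) ∪ (Set.range fun k : ℕ => w.bwd^[k] x)

/-- There are `n` points of `X ∖ cl 𝒩` whose joint `ℤ`-orbit under `φ` is dense in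
`X ∖ cl 𝒩`. -/
def GeneratedBy (w : TypeIWitness T) (n : ℕ) : Prop :=
  ∃ x : Fin n → X, (∀ i, x i ∉ closure w.NSet) ∧
    (closure w.NSet)ᶜ ⊆ closure (⋃ i, w.orbit (x i))

/-- `n` is the least number of points of `X ∖ cl 𝒩` whose joint orbit is dense in
`X ∖ cl 𝒩`. -/
def IsNGenerated (w : TypeIWitness T) (n : ℕ) : Prop :=
  w.GeneratedBy n ∧ ∀ m < n, ¬w.GeneratedBy m

/-- `T` (with witness `w`) is `∞`-generated. -/
def InftyGenerated (w : TypeIWitness T) : Prop :=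
  ∀ n : ℕ, ¬w.GeneratedBy n

end TypeIWitness

open Filter

/-- A continuous self-map `ψ` onto the complement of an isolated point `p`, with a continuous sign
`ε`, whose orbit of `p` converges and which has isolated cycles of lengths `2 ^ (j + 2)` and total
sign `-1`, these cycles and the orbit of `p` being dense. -/
structure SignedCycleSystem (X : Type*) [TopologicalSpace X] where
  p : X
  ψ : X → X
  isOpen_p : IsOpen ({p} : Set X)
  continuous_ψ : Continuous ψ
  injective_ψ : Function.Injective ψ
  range_ψ : Set.range ψ = {p}ᶜ
  ε : X → ℝ
  continuous_ε : Continuous ε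
  ε_sq : ∀ x, ε x * ε x = 1
  ε_p : ∀ k, ε (ψ^[k] p) = 1
  l : X
  tendsto_p : Tendsto (fun k => ψ^[k] p) atTop (𝓝 l)
  y : ℕ → X
  isOpen_y : ∀ j, IsOpen ({y j} : Set X)
  period : ∀ j, ψ^[2 ^ (j + 2)] (y j) = y j
  sign : ∀ j, ∏ m ∈ Finset.range (2 ^ (j + 2)), ε (ψ^[m] (y j)) = -1
  separated : ∀ a b i j, ψ^[a] (y i) = ψ^[b] (y j) → i = j
  dense : Dense (Set.range (fun k => ψ^[k] p) ∪ Set.range fun q : ℕ × ℕ => ψ^[q.2] (y q.1))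

namespace SignedCycleSystem

/-- Transport of a system along a homeomorphism. -/
def map {X Y : Type*} [TopologicalSpace X] [TopologicalSpace Y] (D : SignedCycleSystem X)
    (h : X ≃ₜ Y) : SignedCycleSystem Y :=
  have key : ∀ (k : ℕ) (x : X), (h ∘ D.ψ ∘ h.symm)^[k] (h x) = h (D.ψ^[k] x) := fun k x =>
    (Function.Semiconj.iterate_right (f := h) (ga := D.ψ) (gb := h ∘ D.ψ ∘ h.symm)
      (fun x => by simp) k x).symm
  { p := h D.p
    ψ := h ∘ D.ψ ∘ h.symm
    isOpen_p := by
      rw [← Set.image_singleton]; exact h.isOpen_image.2 D.isOpen_p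
    continuous_ψ := h.continuous.comp (D.continuous_ψ.comp h.symm.continuous)
    injective_ψ := h.injective.comp (D.injective_ψ.comp h.symm.injective)
    range_ψ := by
      rw [Set.range_comp, h.symm.surjective.range_comp, D.range_ψ, Set.image_compl_eq h.bijective,
        Set.image_singleton]
    ε := D.ε ∘ h.symm
    continuous_ε := D.continuous_ε.comp h.symm.continuous
    ε_sq := fun x => D.ε_sq _
    ε_p := fun k => by rw [key]; simpa using D.ε_p k
    l := h D.l
    tendsto_p := by
      simp only [key]
      exact (h.continuous.tendsto _).comp D.tendsto_p
    y := h ∘ D.y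
    isOpen_y := fun j => by
      rw [Function.comp_apply, ← Set.image_singleton]; exact h.isOpen_image.2 (D.isOpen_y j)
    period := fun j => by rw [Function.comp_apply, key, D.period]
    sign := fun j => by
      simp only [Function.comp_apply, key]
      simpa using D.sign j
    separated := fun a b i j hij => by
      simp only [Function.comp_apply, key] at hij
      exact D.separated a b i j (h.injective hij)
    dense := by
      simp only [Function.comp_apply, key]
      have := h.surjective.denseRange.dense_image h.continuous D.dense
      rw [Set.image_union, ← Set.range_comp, ← Set.range_comp] at this
      exact this }

variable {X : Type*} [TopologicalSpace X] (D : SignedCycleSystem X)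

/-- The cocycle of signs along `ψ`. -/
noncomputable def cocycle (k : ℕ) (x : X) : ℝ := ∏ m ∈ Finset.range k, D.ε (D.ψ^[m] x)

theorem abs_ε (x : X) : |D.ε x| = 1 := by
  have := D.ε_sq x
  rw [← abs_mul_abs_self] at this
  nlinarith [abs_nonneg (D.ε x)]

theorem abs_cocycle (k : ℕ) (x : X) : |D.cocycle k x| = 1 := by
  simp [cocycle, Finset.abs_prod, abs_ε]

theorem cocycle_p (k : ℕ) : D.cocycle k D.p = 1 := by
  simp [cocycle, ε_p]

theorem cocycle_succ (k : ℕ) (x : X) : D.cocycle (k + 1) x = D.ε x * D.cocycle k (D.ψ x) := by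
  simp [cocycle, Finset.prod_range_succ', mul_comm]

theorem cocycle_y_add (k j : ℕ) :
    D.cocycle (k + 2 ^ (j + 2)) (D.y j) = -D.cocycle k (D.y j) := by
  rw [cocycle, add_comm, Finset.prod_range_add, D.sign]
  simp only [add_comm (2 ^ (j + 2)), Function.iterate_add_apply, D.period]
  rw [cocycle]; ring

theorem ψ_ne_p (x : X) : D.ψ x ≠ D.p := by
  have : D.ψ x ∈ Set.range D.ψ := ⟨x, rfl⟩
  rw [D.range_ψ] at this
  exact this

theorem exists_ψ_eq {x : X} (hx : x ≠ D.p) : ∃ z, D.ψ z = x := by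
  have : x ∈ Set.range D.ψ := by rw [D.range_ψ]; exact hx
  exact this

theorem iterate_mul_period (j n : ℕ) : D.ψ^[2 ^ (j + 2) * n] (D.y j) = D.y j := by
  rw [Function.iterate_mul]
  exact Function.iterate_fixed (D.period j) n

theorem y_ne_orbit (j k : ℕ) : D.y j ≠ D.ψ^[k] D.p := by
  intro h
  have h1 := D.period j
  rw [h, ← Function.iterate_add_apply, add_comm, Function.iterate_add_apply] at h1
  have h2 := D.injective_ψ.iterate k h1
  obtain ⟨m, hm⟩ : ∃ m, 2 ^ (j + 2) = m + 1 := ⟨2 ^ (j + 2) - 1, by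
    have := Nat.one_le_two_pow (n := j + 2); omega⟩
  rw [hm, Function.iterate_succ_apply'] at h2
  exact D.ψ_ne_p _ h2

variable {𝕂 : Type*} [RCLike 𝕂]

theorem norm_ε (x : X) : ‖(D.ε x : 𝕂)‖ = 1 := by
  rw [RCLike.norm_ofReal, abs_ε]

/-- The left inverse of the shift. -/
def back : C(X, 𝕂) →ₗ[𝕂] C(X, 𝕂) where
  toFun f := ⟨fun x => (D.ε x : 𝕂) * f (D.ψ x),
    (RCLike.continuous_ofReal.comp D.continuous_ε).mul (f.continuous.comp D.continuous_ψ)⟩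
  map_add' f g := by ext x; simp [mul_add]
  map_smul' c f := by ext x; simp [mul_left_comm]

theorem back_apply (f : C(X, 𝕂)) (x : X) : D.back f x = (D.ε x : 𝕂) * f (D.ψ x) := rfl

theorem ε_mul_ε_mul (x : X) (c : 𝕂) : (D.ε x : 𝕂) * ((D.ε x : 𝕂) * c) = c := by
  rw [← mul_assoc, ← RCLike.ofReal_mul, D.ε_sq, RCLike.ofReal_one, one_mul]

theorem back_iterate_apply (k : ℕ) (f : C(X, 𝕂)) (x : X) :
    D.back^[k] f x = (D.cocycle k x : 𝕂) * f (D.ψ^[k] x) := by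
  induction k generalizing x with
  | zero => simp [cocycle]
  | succ k ih =>
    rw [Function.iterate_succ_apply', back_apply, ih, cocycle_succ, Function.iterate_succ_apply,
      RCLike.ofReal_mul, mul_assoc]

theorem antiperiodic_back (f : C(X, 𝕂)) (j : ℕ) :
    Function.Antiperiodic (fun k => D.back^[k] f (D.y j)) (2 ^ (j + 2)) := by
  intro k
  simp only [back_iterate_apply]
  rw [cocycle_y_add, Function.iterate_add_apply, D.period]
  simp

theorem norm_back_iterate (f : C(X, 𝕂)) (k : ℕ) (x : X) :
    ‖D.back^[k] f x‖ = ‖f (D.ψ^[k] x)‖ := by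
  rw [back_iterate_apply, norm_mul, RCLike.norm_ofReal, abs_cocycle, one_mul]

theorem summable_weight {f : ℕ → 𝕂} {M : ℝ} (hf : ∀ j, ‖f j‖ ≤ M) :
    Summable fun j => ((3⁻¹ : ℝ) ^ (j + 1)) • f j := by
  refine Summable.of_norm_bounded (g := fun j => (3⁻¹ : ℝ) ^ (j + 1) * M) ?_ fun j => ?_
  · exact ((summable_nat_add_iff 1).2
      (summable_geometric_of_lt_one (by norm_num) (by norm_num))).mul_right M
  · rw [norm_smul, Real.norm_of_nonneg (by positivity)]
    exact mul_le_mul_of_nonneg_left (hf j) (by positivity)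

theorem norm_tsum_weight_le {f : ℕ → 𝕂} {M : ℝ} (n : ℕ) (hf : ∀ j, ‖f j‖ ≤ M) :
    ‖∑' j, ((3⁻¹ : ℝ) ^ (j + n + 1)) • f j‖ ≤ (3⁻¹ : ℝ) ^ n * (M / 2) := by
  refine tsum_of_norm_bounded (g := fun j => (3⁻¹ : ℝ) ^ j * ((3⁻¹ : ℝ) ^ (n + 1) * M)) ?_
    fun j => ?_
  · have := (hasSum_geometric_of_lt_one (r := (3⁻¹ : ℝ)) (by norm_num) (by norm_num)).mul_right
      ((3⁻¹ : ℝ) ^ (n + 1) * M)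
    rwa [show (1 - 3⁻¹ : ℝ)⁻¹ * ((3⁻¹ : ℝ) ^ (n + 1) * M) = (3⁻¹ : ℝ) ^ n * (M / 2) by
      rw [pow_succ]; ring] at this
  · rw [norm_smul, Real.norm_of_nonneg (by positivity), ← mul_assoc, ← pow_add, ← add_assoc]
    exact mul_le_mul_of_nonneg_left (hf j) (by positivity)

variable [CompactSpace X]

/-- The functional giving the value of the shift at the isolated point. -/
noncomputable def functional : C(X, 𝕂) →L[𝕂] 𝕂 :=
  LinearMap.mkContinuous
    { toFun := fun f => ∑' j, ((3⁻¹ : ℝ) ^ (j + 1)) • f (D.y j)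
      map_add' := fun f g => by
        rw [← Summable.tsum_add (summable_weight fun j => f.norm_coe_le_norm _)
          (summable_weight fun j => g.norm_coe_le_norm _)]
        simp
      map_smul' := fun c f => by
        simp only [ContinuousMap.coe_smul, Pi.smul_apply, RingHom.id_apply]
        rw [← tsum_const_smul'']
        exact tsum_congr fun j => smul_comm _ _ _ }
    (1 / 2) fun f => by
      have := norm_tsum_weight_le 0 (fun j => f.norm_coe_le_norm (D.y j))
      rw [pow_zero, one_mul, ← one_div_mul_eq_div] at this
      exact this

theorem functional_apply (f : C(X, 𝕂)) :
    D.functional f = ∑' j, ((3⁻¹ : ℝ) ^ (j + 1)) • f (D.y j) := rfl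

theorem norm_functional_le (f : C(X, 𝕂)) : ‖D.functional f‖ ≤ ‖f‖ / 2 := by
  have := norm_tsum_weight_le 0 (fun j => f.norm_coe_le_norm (D.y j))
  rw [pow_zero, one_mul] at this
  exact this

/-- The functional whose kernel is the range of the shift. -/
noncomputable def defect : C(X, 𝕂) →ₗ[𝕂] 𝕂 where
  toFun f := f D.p - D.functional (D.back f)
  map_add' f g := by simp; ring
  map_smul' c f := by simp; ring

theorem two_mul_norm_le_of_tendsto (f : C(X, 𝕂)) {c : 𝕂}
    (h : Tendsto (fun k => D.functional (D.back^[k] f)) atTop (𝓝 c)) (j k : ℕ) :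
    ‖f (D.ψ^[k] (D.y j))‖ ≤ ‖f‖ / 2 := by
  set g : ℕ → ℕ → 𝕂 := fun i k => D.back^[k] f (D.y i) with hg
  have hgf : ∀ i k, ‖g i k‖ ≤ ‖f‖ := fun i k => by
    rw [hg]; dsimp only; rw [norm_back_iterate]; exact f.norm_coe_le_norm _
  have hanti : ∀ i, Function.Antiperiodic (g i) (2 ^ (i + 2)) := D.antiperiodic_back f
  have hper : ∀ {i i'}, i < i' → ∀ m, g i (m + 2 ^ (i' + 2)) = g i m := by
    intro i i' hi m
    have := (hanti i).nat_even_mul_periodic (2 ^ (i' - i - 1))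
    have h2 : 2 ^ (i' + 2) = 2 ^ (i' - i - 1) * (2 * 2 ^ (i + 2)) := by
      rw [← pow_succ', ← pow_add]; congr 1; omega
    rw [h2]
    exact_mod_cast this m
  have hnorm : ∀ n, ‖g j (k + 2 ^ (j + 2) * n)‖ = ‖g j k‖ := by
    intro n
    induction n with
    | zero => simp
    | succ n ih =>
      rw [mul_add, mul_one, ← add_assoc, hanti j, norm_neg, ih]
  have hdiff : ∀ m, D.functional (D.back^[m] f) - D.functional (D.back^[m + 2 ^ (j + 2)] f) =
      ((3⁻¹ : ℝ) ^ (j + 1)) • (2 * g j m) +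
        ∑' i, ((3⁻¹ : ℝ) ^ (i + (j + 1) + 1)) •
          (g (i + (j + 1)) m - g (i + (j + 1)) (m + 2 ^ (j + 2))) := by
    intro m
    have hs : ∀ n, Summable fun i => ((3⁻¹ : ℝ) ^ (i + 1)) • g i n := fun n =>
      summable_weight fun i => hgf i n
    rw [functional_apply, functional_apply, ← (hs m).tsum_sub (hs _)]
    rw [← Summable.sum_add_tsum_nat_add (j + 1) ((hs m).sub (hs _)), Finset.sum_range_succ,
      Finset.sum_eq_zero, zero_add]
    · congr 1
      · rw [← smul_sub, hanti j, sub_neg_eq_add, two_mul]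
      · simp only [smul_sub]
    · intro i hi
      rw [hper (Finset.mem_range.1 hi), sub_self]
  have hle : ∀ n, (3⁻¹ : ℝ) ^ (j + 1) * (2 * ‖g j k‖) - (3⁻¹ : ℝ) ^ (j + 1) * ‖f‖ ≤
      ‖D.functional (D.back^[k + 2 ^ (j + 2) * n] f) -
        D.functional (D.back^[k + 2 ^ (j + 2) * n + 2 ^ (j + 2)] f)‖ := by
    intro n
    rw [hdiff]
    have h1 : ‖((3⁻¹ : ℝ) ^ (j + 1)) • (2 * g j (k + 2 ^ (j + 2) * n))‖ =
        (3⁻¹ : ℝ) ^ (j + 1) * (2 * ‖g j k‖) := by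
      rw [norm_smul, Real.norm_of_nonneg (by positivity), norm_mul, hnorm, RCLike.norm_two]
    have h2 := norm_tsum_weight_le (𝕂 := 𝕂) (M := 2 * ‖f‖) (j + 1)
      (f := fun i => g (i + (j + 1)) (k + 2 ^ (j + 2) * n) -
        g (i + (j + 1)) (k + 2 ^ (j + 2) * n + 2 ^ (j + 2)))
      fun i => (norm_sub_le _ _).trans ((add_le_add (hgf _ _) (hgf _ _)).trans_eq
        (two_mul _).symm)
    rw [mul_div_cancel_left₀ _ (two_ne_zero)] at h2
    rw [← h1]
    exact (sub_le_sub_left h2 _).trans (norm_sub_le_norm_add _ _)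
  have hlim : Tendsto (fun n => ‖D.functional (D.back^[k + 2 ^ (j + 2) * n] f) -
        D.functional (D.back^[k + 2 ^ (j + 2) * n + 2 ^ (j + 2)] f)‖) atTop (𝓝 0) := by
    have ha : Tendsto (fun n => k + 2 ^ (j + 2) * n) atTop atTop :=
      tendsto_atTop_mono (fun n => (Nat.le_mul_of_pos_left n (Nat.two_pow_pos (j + 2))).trans
        (Nat.le_add_left _ _)) tendsto_id
    have hb : Tendsto (fun n => k + 2 ^ (j + 2) * n + 2 ^ (j + 2)) atTop atTop :=
      tendsto_atTop_mono (fun n => Nat.le_add_right _ _) ha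
    simpa using ((h.comp ha).sub (h.comp hb)).norm
  have h0 := ge_of_tendsto' hlim hle
  rw [← mul_sub] at h0
  have h3 : 2 * ‖g j k‖ - ‖f‖ ≤ 0 := by
    by_contra hc
    exact absurd h0 (not_le.2 (mul_pos (by positivity) (not_le.1 hc)))
  have : ‖g j k‖ = ‖f (D.ψ^[k] (D.y j))‖ := D.norm_back_iterate f k _
  linarith

variable [T2Space X]

/-- The homeomorphism onto the complement of `p` induced by `ψ`. -/
noncomputable def homeo : X ≃ₜ {x : X // x ≠ D.p} :=
  Continuous.homeoOfEquivCompactToT2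
    (f := Equiv.ofBijective (fun x => (⟨D.ψ x, D.ψ_ne_p x⟩ : {x : X // x ≠ D.p}))
      ⟨fun x z h => D.injective_ψ (congrArg Subtype.val h), fun x => by
        obtain ⟨z, hz⟩ := D.exists_ψ_eq x.2
        exact ⟨z, Subtype.ext hz⟩⟩)
    (D.continuous_ψ.subtype_mk _)

open Classical in
/-- The function underlying the shift. -/
noncomputable def shiftFun (f : C(X, 𝕂)) (x : X) : 𝕂 :=
  if h : x = D.p then D.functional f
  else (D.ε (D.homeo.symm ⟨x, h⟩) : 𝕂) * f (D.homeo.symm ⟨x, h⟩)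

theorem shiftFun_p (f : C(X, 𝕂)) : D.shiftFun f D.p = D.functional f := by
  simp [shiftFun]

theorem shiftFun_of_ne (f : C(X, 𝕂)) (x : {x : X // x ≠ D.p}) :
    D.shiftFun f x = (D.ε (D.homeo.symm x) : 𝕂) * f (D.homeo.symm x) := by
  rw [shiftFun, dif_neg x.2]

theorem shiftFun_ψ (f : C(X, 𝕂)) (x : X) : D.shiftFun f (D.ψ x) = (D.ε x : 𝕂) * f x := by
  have := D.shiftFun_of_ne f (D.homeo x)
  rwa [Homeomorph.symm_apply_apply] at this

theorem continuous_shiftFun (f : C(X, 𝕂)) : Continuous (D.shiftFun f) := by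
  rw [continuous_iff_continuousAt]
  intro x
  by_cases h : x = D.p
  · subst h
    rw [ContinuousAt, (isOpen_singleton_iff_nhds_eq_pure _).1 D.isOpen_p]
    exact tendsto_pure_left.2 fun s hs => mem_of_mem_nhds hs
  · have : ContinuousOn (D.shiftFun f) {x | x ≠ D.p} := by
      rw [continuousOn_iff_continuous_domRestrict]
      refine Continuous.congr (f := fun x : {x : X // x ≠ D.p} =>
        (D.ε (D.homeo.symm x) : 𝕂) * f (D.homeo.symm x)) ?_ fun x => (D.shiftFun_of_ne f x).symm
      exact (RCLike.continuous_ofReal.comp (D.continuous_ε.comp D.homeo.symm.continuous)).mul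
        (f.continuous.comp D.homeo.symm.continuous)
    exact this.continuousAt (isOpen_ne.mem_nhds h)

/-- The shift as a continuous linear map. -/
noncomputable def shift : C(X, 𝕂) →L[𝕂] C(X, 𝕂) :=
  LinearMap.mkContinuous
    { toFun := fun f => ⟨D.shiftFun f, D.continuous_shiftFun f⟩
      map_add' := fun f g => by
        ext x
        by_cases h : x = D.p
        · simp [shiftFun, h]
        · simp [shiftFun, h, mul_add]
      map_smul' := fun c f => by
        ext x
        by_cases h : x = D.p
        · simp [shiftFun, h]
        · simp [shiftFun, h, mul_left_comm] }
    1 fun f => by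
      rw [one_mul]
      refine (ContinuousMap.norm_le _ (norm_nonneg f)).2 fun x => ?_
      by_cases h : x = D.p
      · subst h
        change ‖D.shiftFun f _‖ ≤ _
        rw [shiftFun_p]
        exact (D.norm_functional_le f).trans (half_le_self (norm_nonneg f))
      · obtain ⟨z, rfl⟩ := D.exists_ψ_eq h
        change ‖D.shiftFun f _‖ ≤ _
        rw [shiftFun_ψ, norm_mul, norm_ε, one_mul]
        exact f.norm_coe_le_norm z

theorem shift_p (f : C(X, 𝕂)) : D.shift f D.p = D.functional f := D.shiftFun_p f

theorem shift_ψ (f : C(X, 𝕂)) (x : X) : D.shift f (D.ψ x) = (D.ε x : 𝕂) * f x :=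
  D.shiftFun_ψ f x

theorem norm_shift (f : C(X, 𝕂)) : ‖D.shift f‖ = ‖f‖ := by
  refine le_antisymm ?_ ?_
  · simpa using (D.shift (𝕂 := 𝕂)).le_of_opNorm_le (LinearMap.mkContinuous_norm_le _ zero_le_one _) f
  · refine (ContinuousMap.norm_le _ (norm_nonneg _)).2 fun x => ?_
    have := (D.shift f).norm_coe_le_norm (D.ψ x)
    rwa [shift_ψ, norm_mul, norm_ε, one_mul] at this

theorem back_shift (f : C(X, 𝕂)) : D.back (D.shift f) = f := by
  ext x
  rw [back_apply, shift_ψ, ε_mul_ε_mul]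

theorem ker_defect :
    LinearMap.ker (D.defect (𝕂 := 𝕂)) =
      LinearMap.range ((D.shift : C(X, 𝕂) →L[𝕂] C(X, 𝕂)) : C(X, 𝕂) →ₗ[𝕂] C(X, 𝕂)) := by
  ext f
  rw [LinearMap.mem_ker, LinearMap.mem_range]
  constructor
  · intro h
    refine ⟨D.back f, ?_⟩
    ext x
    by_cases hx : x = D.p
    · subst hx
      exact (D.shift_p _).trans (sub_eq_zero.1 h).symm
    · obtain ⟨z, rfl⟩ := D.exists_ψ_eq hx
      exact (D.shift_ψ _ _).trans (by rw [back_apply, ε_mul_ε_mul])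
  · rintro ⟨g, rfl⟩
    change D.shift g D.p - D.functional (D.back (D.shift g)) = 0
    rw [back_shift, shift_p, sub_self]

theorem surjective_defect : Function.Surjective (D.defect (𝕂 := 𝕂)) := by
  classical
  have hcl : IsClopen ({D.p} : Set X) := ⟨isClosed_singleton, D.isOpen_p⟩
  let g : C(X, 𝕂) := ⟨Set.indicator {D.p} fun _ => 1, continuous_const.indicator (by
    rw [hcl.frontier_eq]; simp)⟩
  have hg : D.back g = 0 := by
    ext x
    simp [back_apply, g, D.ψ_ne_p x]
  have h1 : D.defect g = 1 := by
    change g D.p - D.functional (D.back g) = 1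
    rw [hg]
    simp [g]
  exact fun c => ⟨c • g, by rw [map_smul, h1, smul_eq_mul, mul_one]⟩

theorem rank_quotient_range_shift :
    Module.rank 𝕂 (C(X, 𝕂) ⧸
      LinearMap.range ((D.shift : C(X, 𝕂) →L[𝕂] C(X, 𝕂)) : C(X, 𝕂) →ₗ[𝕂] C(X, 𝕂))) = 1 := by
  rw [← ker_defect]
  have := (D.defect (𝕂 := 𝕂)).quotKerEquivOfSurjective D.surjective_defect
  simpa using this.lift_rank_eq

theorem iInter_range_shift :
    (⋂ n : ℕ, Set.range ((⇑(D.shift : C(X, 𝕂) →L[𝕂] C(X, 𝕂)))^[n + 1])) = {0} := by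
  refine Set.eq_singleton_iff_unique_mem.2 ⟨Set.mem_iInter.2 fun n => ⟨0, ?_⟩, fun f hf => ?_⟩
  · exact Function.iterate_fixed (map_zero _) _
  have hval : ∀ n, D.functional (D.back^[n + 1] f) = f (D.ψ^[n] D.p) := by
    intro n
    obtain ⟨g, hg⟩ := Set.mem_iInter.1 hf n
    have hleft : Function.LeftInverse (D.back (𝕂 := 𝕂)) D.shift := D.back_shift
    have h1 : D.back^[n] f = D.shift g := by
      rw [← hg, Function.iterate_succ_apply, hleft.iterate n]
    have h2 : D.back^[n] f D.p = f (D.ψ^[n] D.p) := by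
      rw [back_iterate_apply, cocycle_p]; simp
    rw [← h2, Function.iterate_succ_apply', h1, back_shift, shift_p]
  have hlim : Tendsto (fun k => D.functional (D.back^[k] f)) atTop (𝓝 (f D.l)) := by
    rw [← tendsto_add_atTop_iff_nat 1]
    simp only [hval]
    exact (f.continuous.tendsto _).comp D.tendsto_p
  have hhalf : ∀ x, ‖f x‖ ≤ ‖f‖ / 2 := by
    have hclosed : IsClosed {x | ‖f x‖ ≤ ‖f‖ / 2} :=
      isClosed_le f.continuous.norm continuous_const
    refine fun x => hclosed.closure_subset_iff.2 ?_ (D.dense x)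
    rintro _ (⟨k, rfl⟩ | ⟨⟨j, k⟩, rfl⟩)
    · change ‖f (D.ψ^[k] D.p)‖ ≤ ‖f‖ / 2
      rw [← hval]
      refine (D.norm_functional_le _).trans (div_le_div_of_nonneg_right ?_ zero_le_two)
      refine (ContinuousMap.norm_le _ (norm_nonneg _)).2 fun x => ?_
      rw [norm_back_iterate]
      exact f.norm_coe_le_norm _
    · exact D.two_mul_norm_le_of_tendsto f hlim j k
  have := (ContinuousMap.norm_le _ (by positivity)).2 hhalf
  exact norm_eq_zero.1 (le_antisymm (by linarith) (norm_nonneg f))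

theorem isIsometricShift_shift : IsIsometricShift (D.shift : C(X, 𝕂) →L[𝕂] C(X, 𝕂)) :=
  ⟨D.norm_shift, D.rank_quotient_range_shift, D.iInter_range_shift⟩

theorem not_isTypeII_shift : ¬IsTypeII (D.shift : C(X, 𝕂) →L[𝕂] C(X, 𝕂)) := by
  rintro ⟨ψ, b, -, hb, h⟩
  have h1 := h 1 D.p
  rw [shift_p] at h1
  have h2 := D.norm_functional_le (1 : C(X, 𝕂))
  have : Nonempty X := ⟨D.p⟩
  rw [h1, norm_mul, hb] at h2
  simp at h2
  norm_num at h2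

/-- The type I witness of the shift. -/
noncomputable def witness : TypeIWitness (D.shift : C(X, 𝕂) →L[𝕂] C(X, 𝕂)) where
  p := D.p
  isolated := D.isOpen_p
  φ := D.homeo.symm
  a := ⟨fun x => (D.ε (D.homeo.symm x) : 𝕂),
    RCLike.continuous_ofReal.comp (D.continuous_ε.comp D.homeo.symm.continuous)⟩
  norm_a _ := D.norm_ε _
  hT f x := D.shiftFun_of_ne f x

theorem witness_fwd_p : (D.witness (𝕂 := 𝕂)).fwd D.p = D.p := dif_pos rfl

theorem witness_fwd_ψ (x : X) : (D.witness (𝕂 := 𝕂)).fwd (D.ψ x) = x := by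
  rw [TypeIWitness.fwd, dif_neg (show D.ψ x ≠ D.witness.p from D.ψ_ne_p x)]
  exact D.homeo.symm_apply_apply x

theorem witness_nseq (k : ℕ) : (D.witness (𝕂 := 𝕂)).nseq k = D.ψ^[k] D.p := by
  induction k with
  | zero => rfl
  | succ k ih =>
    rw [Function.iterate_succ_apply', ← ih]
    rfl

theorem y_notMem_closure (j : ℕ) : D.y j ∉ closure (D.witness (𝕂 := 𝕂)).NSet := by
  intro h
  obtain ⟨_, h1, k, rfl⟩ := mem_closure_iff.1 h _ (D.isOpen_y j) rfl
  rw [witness_nseq] at h1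
  exact D.y_ne_orbit j k h1.symm

theorem exists_eq_of_mem_orbit {x : X} {j : ℕ} (h : D.y j ∈ (D.witness (𝕂 := 𝕂)).orbit x) :
    ∃ k, x = D.ψ^[k] (D.y j) := by
  rcases h with ⟨k, hk⟩ | ⟨k, hk⟩
  · refine ⟨k, ?_⟩
    have hne : D.y j ≠ D.p := D.y_ne_orbit j 0
    generalize D.y j = z at hk hne
    dsimp only at hk
    induction k generalizing z with
    | zero => exact hk
    | succ k ih =>
      rw [Function.iterate_succ_apply'] at hk
      have hw : (D.witness (𝕂 := 𝕂)).fwd^[k] x ≠ D.p := fun h0 => by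
        rw [h0, witness_fwd_p] at hk
        exact hne hk.symm
      obtain ⟨v, hv⟩ := D.exists_ψ_eq hw
      have hvz : v = z := by rw [← hk, ← hv, witness_fwd_ψ]
      rw [Function.iterate_succ_apply]
      exact ih _ (by rw [← hvz, hv]) (D.ψ_ne_p z)
  · refine ⟨2 ^ (j + 2) * k - k, D.injective_ψ.iterate k ?_⟩
    have hk' : D.ψ^[k] x = D.y j := hk
    rw [← Function.iterate_add_apply, Nat.add_sub_cancel' (Nat.le_mul_of_pos_left k (by positivity)),
      iterate_mul_period, hk']

theorem inftyGenerated_witness : (D.witness (𝕂 := 𝕂)).InftyGenerated := by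
  rintro n ⟨x, -, hx⟩
  have hy : ∀ j, ∃ i, D.y j ∈ (D.witness (𝕂 := 𝕂)).orbit (x i) := by
    intro j
    obtain ⟨_, h1, h2⟩ := mem_closure_iff.1 (hx (D.y_notMem_closure j)) _ (D.isOpen_y j) rfl
    rw [Set.mem_singleton_iff.1 h1] at h2
    exact Set.mem_iUnion.1 h2
  choose i hi using hy
  obtain ⟨j, j', hne, hij⟩ := Finite.exists_ne_map_eq_of_infinite i
  obtain ⟨a, ha⟩ := D.exists_eq_of_mem_orbit (hi j)
  obtain ⟨b, hb⟩ := D.exists_eq_of_mem_orbit (hi j')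
  exact hne (D.separated a b j j' (by rw [← ha, ← hb, hij]))

theorem nonPrimitive_witness : (D.witness (𝕂 := 𝕂)).NonPrimitive := fun h =>
  D.y_notMem_closure (𝕂 := 𝕂) 0 (h ▸ Set.mem_univ _)

end SignedCycleSystem

/-- A rational embedding of the one-point compactification of a countable discrete space. -/
def OnePoint.toRat {D : Type*} [Encodable D] : OnePoint D → ℚ
  | .none => 0
  | .some d => 1 / ((Encodable.encode d : ℚ) + 1)

theorem OnePoint.toRat_injective {D : Type*} [Encodable D] :
    Function.Injective (OnePoint.toRat : OnePoint D → ℚ) := by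
  have hne : ∀ d : D, 1 / ((Encodable.encode d : ℚ) + 1) ≠ 0 := fun d => by positivity
  rintro (_ | d) (_ | d') h
  · rfl
  · exact absurd h.symm (hne d')
  · exact absurd h (hne d)
  · have h1 : 1 / ((Encodable.encode d : ℚ) + 1) = 1 / ((Encodable.encode d' : ℚ) + 1) := h
    rw [one_div, one_div, inv_inj, add_left_inj, Nat.cast_inj] at h1
    rw [Encodable.encode_injective h1]

section OnePointDiscrete

variable {D : Type*} [TopologicalSpace D] [DiscreteTopology D]

theorem OnePoint.isClopen_singleton_coe (d : D) :
    IsClopen ({(d : OnePoint D)} : Set (OnePoint D)) := by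
  refine ⟨isClosed_singleton, ?_⟩
  rw [← Set.image_singleton]
  exact OnePoint.isOpen_image_coe.2 (isOpen_discrete _)

theorem OnePoint.continuous_of_isClopen_preimage {Y : Type*} [TopologicalSpace Y]
    {f : Y → OnePoint D} (h : ∀ d : D, IsClopen (f ⁻¹' {(d : OnePoint D)})) : Continuous f := by
  refine continuous_def.2 fun U hU => ?_
  by_cases hm : OnePoint.infty ∈ U
  · have hfin : ((fun d : D => (d : OnePoint D)) ⁻¹' U)ᶜ.Finite :=
      (((OnePoint.isOpen_iff_of_mem hm).1 hU).2).finite_of_discrete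
    have heq : (f ⁻¹' U)ᶜ = ⋃ d ∈ ((fun d : D => (d : OnePoint D)) ⁻¹' U)ᶜ,
        f ⁻¹' {(d : OnePoint D)} := by
      ext x
      simp only [Set.mem_compl_iff, Set.mem_preimage, Set.mem_iUnion, Set.mem_singleton_iff,
        exists_prop]
      constructor
      · intro hx
        obtain ⟨d, hd⟩ := OnePoint.ne_infty_iff_exists.1 (fun h0 => hx (h0 ▸ hm) : f x ≠ _)
        exact ⟨d, hd ▸ hx, hd.symm⟩
      · rintro ⟨d, hd, hx⟩
        rwa [hx]
    rw [← isClosed_compl_iff, heq]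
    exact hfin.isClosed_biUnion fun d _ => (h d).1
  · have heq : f ⁻¹' U = ⋃ d ∈ ((fun d : D => (d : OnePoint D)) ⁻¹' U),
        f ⁻¹' {(d : OnePoint D)} := by
      ext x
      simp only [Set.mem_preimage, Set.mem_iUnion, Set.mem_singleton_iff, exists_prop]
      constructor
      · intro hx
        obtain ⟨d, hd⟩ := OnePoint.ne_infty_iff_exists.1 (fun h0 => hm (by rwa [h0] at hx) : f x ≠ _)
        exact ⟨d, hd ▸ hx, hd.symm⟩
      · rintro ⟨d, hd, hx⟩
        rwa [hx]
    rw [heq]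
    exact isOpen_biUnion fun d _ => (h d).2

theorem OnePoint.continuous_toRat [Encodable D] :
    Continuous fun x : OnePoint D => (x.toRat : ℝ) := by
  rw [OnePoint.continuous_iff_from_discrete]
  have h1 : Tendsto (fun d : D => Encodable.encode d) cofinite atTop := by
    rw [← Nat.cofinite_eq_atTop]
    exact Encodable.encode_injective.tendsto_cofinite
  have h2 := (tendsto_one_div_add_atTop_nhds_zero_nat (𝕜 := ℝ)).comp h1
  have h3 : ((OnePoint.toRat (OnePoint.infty : OnePoint D) : ℚ) : ℝ) = 0 := Rat.cast_zero
  rw [h3]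
  refine h2.congr fun d => ?_
  have h4 : (OnePoint.toRat (d : OnePoint D)) = 1 / ((Encodable.encode d : ℚ) + 1) := rfl
  rw [h4]
  push_cast
  rfl

end OnePointDiscrete

namespace RowModel

open OnePoint

/-- Translation by one in every row, the rows with positive index being closed up to cycles. -/
def step : OnePoint ℤ → OnePoint ℕ → OnePoint ℤ
  | .some k, .some (n + 1) => if k = 2 ^ (n + 1) - 1 then ((-2 ^ (n + 1) : ℤ) : OnePoint ℤ)
      else ((k + 1 : ℤ) : OnePoint ℤ)
  | .some k, .some 0 => ((k + 1 : ℤ) : OnePoint ℤ)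
  | .some k, .none => ((k + 1 : ℤ) : OnePoint ℤ)
  | .none, _ => ∞

theorem step_infty (j : OnePoint ℕ) : step ∞ j = ∞ := rfl

theorem step_coe_infty (k : ℤ) : step k ∞ = ((k + 1 : ℤ) : OnePoint ℤ) := rfl

theorem step_coe_zero (k : ℤ) : step k ((0 : ℕ) : OnePoint ℕ) = ((k + 1 : ℤ) : OnePoint ℤ) := rfl

theorem step_coe_succ (k : ℤ) (n : ℕ) : step k ((n + 1 : ℕ) : OnePoint ℕ) =
    if k = 2 ^ (n + 1) - 1 then ((-2 ^ (n + 1) : ℤ) : OnePoint ℤ)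
      else ((k + 1 : ℤ) : OnePoint ℤ) := rfl

theorem lt_two_pow_int (n : ℕ) : (n : ℤ) < 2 ^ n := by
  exact_mod_cast Nat.lt_two_pow_self

theorem continuous_step_coe (k : ℤ) : Continuous (step k) := by
  rw [OnePoint.continuous_iff_from_nat]
  refine tendsto_const_nhds.congr' ?_
  filter_upwards [eventually_ge_atTop (k.natAbs + 1)] with n hn
  obtain ⟨m, rfl⟩ : ∃ m, n = m + 1 := ⟨n - 1, by omega⟩
  have := lt_two_pow_int (m + 1)
  rw [step_coe_succ, if_neg (by push_cast at this; omega), step_coe_infty]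

theorem continuous_step : Continuous fun x : OnePoint ℤ × OnePoint ℕ => step x.1 x.2 := by
  refine OnePoint.continuous_of_isClopen_preimage fun m => ?_
  have heq : (fun x : OnePoint ℤ × OnePoint ℕ => step x.1 x.2) ⁻¹' {(m : OnePoint ℤ)} =
      (Prod.fst ⁻¹' {((m - 1 : ℤ) : OnePoint ℤ)} ∩
        Prod.snd ⁻¹' (step ((m - 1 : ℤ) : OnePoint ℤ) ⁻¹' {(m : OnePoint ℤ)})) ∪
      (Prod.fst ⁻¹' {((-m - 1 : ℤ) : OnePoint ℤ)} ∩
        Prod.snd ⁻¹' (step ((-m - 1 : ℤ) : OnePoint ℤ) ⁻¹' {(m : OnePoint ℤ)})) := by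
    ext ⟨i, j⟩
    simp only [Set.mem_preimage, Set.mem_singleton_iff, Set.mem_union, Set.mem_inter_iff]
    constructor
    · intro h
      induction i using OnePoint.rec with
      | infty => exact absurd h.symm (OnePoint.coe_ne_infty m)
      | coe k =>
        have hk : k = m - 1 ∨ k = -m - 1 := by
          induction j using OnePoint.rec with
          | infty =>
            rw [step_coe_infty, OnePoint.coe_eq_coe] at h
            omega
          | coe n =>
            cases n with
            | zero =>
              rw [step_coe_zero, OnePoint.coe_eq_coe] at h
              omega
            | succ n =>
              rw [step_coe_succ] at h
              split_ifs at h with hc <;> rw [OnePoint.coe_eq_coe] at h <;> omega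
        rcases hk with rfl | rfl
        · exact Or.inl ⟨rfl, h⟩
        · exact Or.inr ⟨rfl, h⟩
    · rintro (⟨rfl, h⟩ | ⟨rfl, h⟩) <;> exact h
  rw [heq]
  have hs : ∀ a : ℤ, IsClopen (Prod.fst ⁻¹' {(a : OnePoint ℤ)} ∩
      Prod.snd ⁻¹' (step (a : OnePoint ℤ) ⁻¹' {(m : OnePoint ℤ)}) :
        Set (OnePoint ℤ × OnePoint ℕ)) := fun a =>
    ((OnePoint.isClopen_singleton_coe a).preimage continuous_fst).inter
      (((OnePoint.isClopen_singleton_coe m).preimage (continuous_step_coe a)).preimage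
        continuous_snd)
  exact (hs _).union (hs _)

/-- The admissible positions in the rows. -/
def rows : ℕ → Set (OnePoint ℤ)
  | 0 => {x | ∀ k : ℤ, x = k → 1 ≤ k}
  | n + 1 => {x | ∃ k : ℤ, x = k ∧ -2 ^ (n + 1) ≤ k ∧ k < 2 ^ (n + 1)}

theorem infty_mem_rows_zero : ∞ ∈ rows 0 := fun k h => absurd h.symm (OnePoint.coe_ne_infty k)

theorem coe_mem_rows_zero {k : ℤ} : (k : OnePoint ℤ) ∈ rows 0 ↔ 1 ≤ k :=
  ⟨fun h => h k rfl, fun h _ hm => OnePoint.coe_eq_coe.1 hm ▸ h⟩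

theorem coe_mem_rows_succ {k : ℤ} {n : ℕ} :
    (k : OnePoint ℤ) ∈ rows (n + 1) ↔ -2 ^ (n + 1) ≤ k ∧ k < 2 ^ (n + 1) :=
  ⟨fun ⟨m, hm, h⟩ => by rwa [OnePoint.coe_eq_coe.1 hm], fun h => ⟨k, rfl, h⟩⟩

theorem isClosed_rows (n : ℕ) : IsClosed (rows n) := by
  cases n with
  | zero =>
    have : rows 0 = ⋂ k : ℤ, ⋂ _ : k < 1, {(k : OnePoint ℤ)}ᶜ := by
      ext x
      simp only [rows, Set.mem_ofPred_eq, Set.mem_iInter, Set.mem_compl_iff, Set.mem_singleton_iff]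
      exact forall_congr' fun k => ⟨fun h hk hx => by have := h hx; omega,
        fun h hx => by by_contra hc; exact h (not_le.1 hc) hx⟩
    rw [this]
    exact isClosed_iInter fun k => isClosed_iInter fun _ =>
      (OnePoint.isClopen_singleton_coe k).compl.1
  | succ n =>
    have : rows (n + 1) =
        (fun k : ℤ => (k : OnePoint ℤ)) '' Set.Ico (-2 ^ (n + 1)) (2 ^ (n + 1)) := by
      ext x
      exact ⟨fun ⟨k, hx, h⟩ => ⟨k, h, hx.symm⟩, fun ⟨k, h, hx⟩ => ⟨k, hx.symm, h⟩⟩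
    rw [this]
    exact ((Set.finite_Ico _ _).image _).isClosed

theorem step_mem_rows {n : ℕ} {i : OnePoint ℤ} (h : i ∈ rows n) : step i n ∈ rows n := by
  cases n with
  | zero =>
    induction i using OnePoint.rec with
    | infty => exact h
    | coe k =>
      rw [coe_mem_rows_zero] at h
      rw [step_coe_zero, coe_mem_rows_zero]
      omega
  | succ n =>
    obtain ⟨k, rfl, h1, h2⟩ := h
    rw [step_coe_succ]
    split_ifs with hc <;> rw [coe_mem_rows_succ] <;> constructor <;> omega

theorem step_injective_infty {i i' : OnePoint ℤ} (h : step i ∞ = step i' ∞) : i = i' := by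
  induction i using OnePoint.rec <;> induction i' using OnePoint.rec <;>
    simp_all [step_infty, step_coe_infty]

theorem step_injOn_rows (n : ℕ) : Set.InjOn (fun i => step i n) (rows n) := by
  intro i hi i' hi' h
  dsimp only at h
  cases n with
  | zero =>
    induction i using OnePoint.rec <;> induction i' using OnePoint.rec <;>
      simp_all [step_infty, step_coe_zero]
  | succ n =>
    obtain ⟨k, rfl, h1, h2⟩ := hi
    obtain ⟨k', rfl, h1', h2'⟩ := hi'
    rw [step_coe_succ, step_coe_succ] at h
    rw [OnePoint.coe_eq_coe]
    split_ifs at h <;> rw [OnePoint.coe_eq_coe] at h <;> omega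

theorem exists_step_eq_infty (i : OnePoint ℤ) : ∃ i', step i' ∞ = i := by
  induction i using OnePoint.rec with
  | infty => exact ⟨∞, rfl⟩
  | coe k => exact ⟨((k - 1 : ℤ) : OnePoint ℤ), by rw [step_coe_infty, sub_add_cancel]⟩

theorem exists_step_eq {n : ℕ} {i : OnePoint ℤ} (h : i ∈ rows n)
    (hne : n = 0 → i ≠ ((1 : ℤ) : OnePoint ℤ)) : ∃ i' ∈ rows n, step i' n = i := by
  cases n with
  | zero =>
    induction i using OnePoint.rec with
    | infty => exact ⟨∞, h, rfl⟩
    | coe k =>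
      rw [coe_mem_rows_zero] at h
      have : k ≠ 1 := fun hk => hne rfl (by rw [hk])
      exact ⟨((k - 1 : ℤ) : OnePoint ℤ), coe_mem_rows_zero.2 (by omega), by
        rw [step_coe_zero, sub_add_cancel]⟩
  | succ n =>
    obtain ⟨k, rfl, h1, h2⟩ := h
    by_cases hk : k = -2 ^ (n + 1)
    · refine ⟨((2 ^ (n + 1) - 1 : ℤ) : OnePoint ℤ), coe_mem_rows_succ.2 ⟨by omega, by omega⟩, ?_⟩
      rw [step_coe_succ, if_pos rfl, hk]
    · refine ⟨((k - 1 : ℤ) : OnePoint ℤ), coe_mem_rows_succ.2 ⟨by omega, by omega⟩, ?_⟩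
      rw [step_coe_succ, if_neg (by omega), sub_add_cancel]

theorem step_ne_one {i : OnePoint ℤ} (h : i ∈ rows 0) :
    step i ((0 : ℕ) : OnePoint ℕ) ≠ ((1 : ℤ) : OnePoint ℤ) := by
  induction i using OnePoint.rec with
  | infty => exact OnePoint.infty_ne_coe _
  | coe k =>
    rw [coe_mem_rows_zero] at h
    rw [step_coe_zero, Ne, OnePoint.coe_eq_coe]
    omega

/-- The heights of the rows, approximating every point of the interval infinitely often. -/
noncomputable def height (n : ℕ) : unitInterval :=
  TopologicalSpace.denseSeq unitInterval n.unpair.1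

theorem exists_tendsto_height (t : unitInterval) :
    ∃ u : ℕ → ℕ, Tendsto u atTop atTop ∧ Tendsto (fun i => height (u i)) atTop (𝓝 t) := by
  have h : ∀ i : ℕ, ∃ m, dist t (TopologicalSpace.denseSeq unitInterval m) < 1 / ((i : ℝ) + 1) :=
    fun i => (TopologicalSpace.denseRange_denseSeq unitInterval).exists_dist_lt t (by positivity)
  choose m hm using h
  refine ⟨fun i => Nat.pair (m i) i, tendsto_atTop_mono (fun i => Nat.right_le_pair _ _) tendsto_id,
    ?_⟩
  simp only [height, Nat.unpair_pair]
  rw [tendsto_iff_dist_tendsto_zero]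
  refine squeeze_zero (fun _ => dist_nonneg) (fun i => ?_)
    (tendsto_one_div_add_atTop_nhds_zero_nat (𝕜 := ℝ))
  rw [dist_comm]
  exact (hm i).le

/-- The model space: intervals indexed by `OnePoint ℤ`, a sequence converging to a point,
and finite rows accumulating on the intervals. -/
def space : Set (OnePoint ℤ × OnePoint ℕ × unitInterval) :=
  {x | ∀ n : ℕ, x.2.1 = n → x.2.2 = height n ∧ x.1 ∈ rows n}

theorem isClosed_space : IsClosed space := by
  have : space = ⋂ n : ℕ, ((fun x => x.2.1) ⁻¹' {(n : OnePoint ℕ)}ᶜ ∪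
      ((fun x => x.2.2) ⁻¹' {height n} ∩ Prod.fst ⁻¹' rows n)) := by
    ext x
    simp only [space, Set.mem_ofPred_eq, Set.mem_iInter, Set.mem_union, Set.mem_inter_iff,
      Set.mem_preimage, Set.mem_compl_iff, Set.mem_singleton_iff]
    exact forall_congr' fun n => by tauto
  rw [this]
  exact isClosed_iInter fun n =>
    ((OnePoint.isClopen_singleton_coe n).compl.1.preimage (by fun_prop)).union
      ((isClosed_singleton.preimage (by fun_prop)).inter
        ((isClosed_rows n).preimage continuous_fst))

instance : CompactSpace space := isCompact_iff_compactSpace.1 isClosed_space.isCompact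

theorem mem_space_infty (i : OnePoint ℤ) (t : unitInterval) : (i, ∞, t) ∈ space := fun n h =>
  absurd h.symm (OnePoint.coe_ne_infty n)

theorem mem_space_coe {i : OnePoint ℤ} {n : ℕ} (h : i ∈ rows n) :
    (i, (n : OnePoint ℕ), height n) ∈ space := fun m hm => by
  rw [← OnePoint.coe_eq_coe.1 hm]
  exact ⟨rfl, h⟩

/-- The point of a row at an admissible position. -/
noncomputable def rowPoint (n : ℕ) (i : OnePoint ℤ) (h : i ∈ rows n) : space :=
  ⟨(i, n, height n), mem_space_coe h⟩

theorem eq_rowPoint {x : space} {n : ℕ} (h : x.1.2.1 = n) :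
    x = rowPoint n x.1.1 (x.2 n h).2 :=
  Subtype.ext (Prod.ext rfl (Prod.ext h (x.2 n h).1))

theorem isOpen_rowPoint {n : ℕ} {k : ℤ} (h : (k : OnePoint ℤ) ∈ rows n) :
    IsOpen ({rowPoint n k h} : Set space) := by
  have : ({rowPoint n k h} : Set space) = (fun x : space => x.1.1) ⁻¹' {(k : OnePoint ℤ)} ∩
      (fun x : space => x.1.2.1) ⁻¹' {(n : OnePoint ℕ)} := by
    ext x
    constructor
    · rintro rfl
      exact ⟨rfl, rfl⟩
    · rintro ⟨h1, h2⟩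
      have h1' : x.1.1 = k := h1
      refine (eq_rowPoint h2).trans ?_
      exact Subtype.ext (Prod.ext h1' rfl)
  rw [this]
  exact ((OnePoint.isClopen_singleton_coe k).2.preimage (by fun_prop)).inter
    ((OnePoint.isClopen_singleton_coe n).2.preimage (by fun_prop))

/-- The self-map of the model space. -/
def shiftMap (x : space) : space :=
  ⟨(step x.1.1 x.1.2.1, x.1.2.1, x.1.2.2), fun n h => ⟨(x.2 n h).1, by
    have h' : x.1.2.1 = n := h
    change step x.1.1 x.1.2.1 ∈ rows n
    rw [h']
    exact step_mem_rows (x.2 n h).2⟩⟩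

theorem continuous_shiftMap : Continuous shiftMap :=
  ((continuous_step.comp (by fun_prop :
    Continuous fun x : space => (x.1.1, x.1.2.1))).prodMk (by fun_prop)).subtype_mk _

theorem shiftMap_rowPoint {n : ℕ} {i : OnePoint ℤ} (h : i ∈ rows n) :
    shiftMap (rowPoint n i h) = rowPoint n (step i n) (step_mem_rows h) := rfl

theorem injective_shiftMap : Function.Injective shiftMap := by
  intro x z h
  have h1 : step x.1.1 x.1.2.1 = step z.1.1 z.1.2.1 := congrArg (fun x : space => x.1.1) h
  have h2 : x.1.2 = z.1.2 := by
    have h0 : (shiftMap x).1.2 = (shiftMap z).1.2 := by rw [h]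
    exact h0
  refine Subtype.ext (Prod.ext ?_ h2)
  have h3 : z.1.2.1 = x.1.2.1 := by rw [h2]
  rw [h3] at h1
  rcases eq_or_ne x.1.2.1 ∞ with h4 | h4
  · rw [h4] at h1
    exact step_injective_infty h1
  · obtain ⟨n, hn⟩ := OnePoint.ne_infty_iff_exists.1 h4
    rw [← hn] at h1
    exact step_injOn_rows n (x.2 n hn.symm).2 (z.2 n (h3.trans hn.symm)).2 h1

theorem one_mem_rows_zero : ((1 : ℤ) : OnePoint ℤ) ∈ rows 0 := coe_mem_rows_zero.2 le_rfl

theorem range_shiftMap : Set.range shiftMap = {rowPoint 0 (1 : ℤ) one_mem_rows_zero}ᶜ := by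
  ext x
  rw [Set.mem_compl_singleton_iff]
  constructor
  · rintro ⟨z, rfl⟩ h
    have h1 : step z.1.1 z.1.2.1 = ((1 : ℤ) : OnePoint ℤ) := congrArg (fun x : space => x.1.1) h
    have h2 : z.1.2.1 = ((0 : ℕ) : OnePoint ℕ) := congrArg (fun x : space => x.1.2.1) h
    rw [h2] at h1
    exact step_ne_one (z.2 0 h2).2 h1
  · intro hx
    rcases eq_or_ne x.1.2.1 ∞ with h | h
    · obtain ⟨i, hi⟩ := exists_step_eq_infty x.1.1
      refine ⟨⟨(i, ∞, x.1.2.2), mem_space_infty _ _⟩, Subtype.ext (Prod.ext hi ?_)⟩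
      exact Prod.ext h.symm rfl
    · obtain ⟨n, hn⟩ := OnePoint.ne_infty_iff_exists.1 h
      have hxr := eq_rowPoint hn.symm
      obtain ⟨i, hi, hs⟩ := exists_step_eq (x.2 n hn.symm).2 (by
        rintro rfl h1
        exact hx (hxr.trans (Subtype.ext (Prod.ext h1 rfl))))
      refine ⟨rowPoint n i hi, ?_⟩
      rw [shiftMap_rowPoint, hxr]
      exact Subtype.ext (Prod.ext hs rfl)

open Classical in
/-- The sign on the model space. -/
noncomputable def sign (x : space) : ℝ := if x.1.1 = ((0 : ℤ) : OnePoint ℤ) then -1 else 1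

theorem continuous_sign : Continuous sign := by
  have hcl : IsClopen {x : space | x.1.1 = ((0 : ℤ) : OnePoint ℤ)} :=
    (OnePoint.isClopen_singleton_coe (0 : ℤ)).preimage
      (by fun_prop : Continuous fun x : space => x.1.1)
  classical
  unfold sign
  exact Continuous.if (by
    intro a ha
    rw [hcl.frontier_eq] at ha
    exact ha.elim) continuous_const continuous_const

theorem neg_two_pow_mem_rows (j : ℕ) : ((-2 ^ (j + 1) : ℤ) : OnePoint ℤ) ∈ rows (j + 1) :=
  coe_mem_rows_succ.2 ⟨le_rfl, by have : (0 : ℤ) < 2 ^ (j + 1) := by positivity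
                                  omega⟩

theorem iterate_shiftMap_zero (k : ℕ) :
    shiftMap^[k] (rowPoint 0 (1 : ℤ) one_mem_rows_zero) =
      rowPoint 0 ((1 + k : ℤ) : OnePoint ℤ) (coe_mem_rows_zero.2 (by omega)) := by
  induction k with
  | zero => simp
  | succ k ih =>
    rw [Function.iterate_succ_apply', ih, shiftMap_rowPoint]
    refine Subtype.ext (Prod.ext ?_ rfl)
    change ((1 + k + 1 : ℤ) : OnePoint ℤ) = ((1 + (k + 1 : ℕ) : ℤ) : OnePoint ℤ)
    rw [OnePoint.coe_eq_coe, Nat.cast_succ, add_assoc]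

theorem iterate_shiftMap_succ {j m : ℕ} (hm : m < 2 ^ (j + 2)) :
    shiftMap^[m] (rowPoint (j + 1) (-2 ^ (j + 1) : ℤ) (neg_two_pow_mem_rows j)) =
      rowPoint (j + 1) ((-2 ^ (j + 1) + m : ℤ) : OnePoint ℤ) (coe_mem_rows_succ.2 (by
        have : (m : ℤ) < 2 ^ (j + 2) := by exact_mod_cast hm
        rw [pow_succ] at this
        constructor <;> omega)) := by
  induction m with
  | zero => simp
  | succ m ih =>
    rw [Function.iterate_succ_apply', ih (by omega), shiftMap_rowPoint]
    refine Subtype.ext (Prod.ext ?_ rfl)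
    change step ((-2 ^ (j + 1) + m : ℤ) : OnePoint ℤ) ((j + 1 : ℕ) : OnePoint ℕ) =
      ((-2 ^ (j + 1) + (m + 1 : ℕ) : ℤ) : OnePoint ℤ)
    have : ((m + 1 : ℕ) : ℤ) < 2 ^ (j + 2) := by exact_mod_cast hm
    rw [pow_succ] at this
    rw [step_coe_succ, if_neg (by push_cast at this; omega)]
    rw [OnePoint.coe_eq_coe, Nat.cast_succ, add_assoc]

theorem period (j : ℕ) :
    shiftMap^[2 ^ (j + 2)] (rowPoint (j + 1) (-2 ^ (j + 1) : ℤ) (neg_two_pow_mem_rows j)) =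
      rowPoint (j + 1) (-2 ^ (j + 1) : ℤ) (neg_two_pow_mem_rows j) := by
  obtain ⟨m, hm⟩ : ∃ m, 2 ^ (j + 2) = m + 1 := ⟨2 ^ (j + 2) - 1, by
    have := Nat.one_le_two_pow (n := j + 2); omega⟩
  rw [hm, Function.iterate_succ_apply', iterate_shiftMap_succ (by omega), shiftMap_rowPoint]
  refine Subtype.ext (Prod.ext ?_ rfl)
  change step ((-2 ^ (j + 1) + m : ℤ) : OnePoint ℤ) ((j + 1 : ℕ) : OnePoint ℕ) =
    ((-2 ^ (j + 1) : ℤ) : OnePoint ℤ)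
  have : (2 : ℤ) ^ (j + 2) = m + 1 := by exact_mod_cast hm
  rw [pow_succ] at this
  rw [step_coe_succ, if_pos (by omega)]

theorem row_iterate (k : ℕ) (x : space) : (shiftMap^[k] x).1.2 = x.1.2 := by
  induction k with
  | zero => rfl
  | succ k ih => rw [Function.iterate_succ_apply']; exact ih

theorem tendsto_coe_natCast_add (c : ℤ) :
    Tendsto (fun k : ℕ => ((c + k : ℤ) : OnePoint ℤ)) atTop (𝓝 ∞) := by
  have h1 : Tendsto (fun k : ℤ => (k : OnePoint ℤ)) cofinite (𝓝 ∞) :=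
    (OnePoint.continuous_iff_from_discrete id).1 continuous_id
  refine h1.comp ?_
  rw [← Nat.cofinite_eq_atTop]
  exact Function.Injective.tendsto_cofinite fun a b h => by simpa using h

theorem tendsto_coe_nat : Tendsto (fun n : ℕ => (n : OnePoint ℕ)) atTop (𝓝 ∞) :=
  (OnePoint.continuous_iff_from_nat id).1 continuous_id

theorem dense_orbits :
    Dense (Set.range (fun k => shiftMap^[k] (rowPoint 0 (1 : ℤ) one_mem_rows_zero)) ∪
      Set.range fun q : ℕ × ℕ => shiftMap^[q.2]
        (rowPoint (q.1 + 1) (-2 ^ (q.1 + 1) : ℤ) (neg_two_pow_mem_rows q.1))) := by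
  rw [Subtype.dense_iff]
  set O := ((↑) : space → OnePoint ℤ × OnePoint ℕ × unitInterval) ''
    (Set.range (fun k => shiftMap^[k] (rowPoint 0 (1 : ℤ) one_mem_rows_zero)) ∪
      Set.range fun q : ℕ × ℕ => shiftMap^[q.2]
        (rowPoint (q.1 + 1) (-2 ^ (q.1 + 1) : ℤ) (neg_two_pow_mem_rows q.1))) with hO
  have h0 : ∀ k : ℕ, (((1 + k : ℤ) : OnePoint ℤ), ((0 : ℕ) : OnePoint ℕ), height 0) ∈ O :=
    fun k => ⟨_, Or.inl ⟨k, rfl⟩, congrArg Subtype.val (iterate_shiftMap_zero k)⟩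
  have h1 : ∀ (k : ℤ) (n : ℕ), -2 ^ (n + 1) ≤ k → k < 2 ^ (n + 1) →
      ((k : OnePoint ℤ), ((n + 1 : ℕ) : OnePoint ℕ), height (n + 1)) ∈ O := by
    intro k n hk1 hk2
    obtain ⟨m, hm⟩ := Int.eq_ofNat_of_zero_le (by omega : 0 ≤ k + 2 ^ (n + 1))
    have hm2 : m < 2 ^ (n + 2) := by
      have : (m : ℤ) < 2 ^ (n + 2) := by rw [pow_succ]; omega
      exact_mod_cast this
    have hk : k = -2 ^ (n + 1) + m := by omega
    subst hk
    exact ⟨_, Or.inr ⟨(n, m), rfl⟩, congrArg Subtype.val (iterate_shiftMap_succ hm2)⟩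
  have h2 : ∀ (k : ℤ) (t : unitInterval), ((k : OnePoint ℤ), (∞ : OnePoint ℕ), t) ∈ closure O := by
    intro k t
    obtain ⟨u, hu, ht⟩ := exists_tendsto_height t
    refine mem_closure_of_tendsto
      (tendsto_const_nhds.prodMk_nhds ((tendsto_coe_nat.comp hu).prodMk_nhds ht)) ?_
    filter_upwards [hu.eventually_ge_atTop (k.natAbs + 1)] with i hi
    obtain ⟨m, hm⟩ : ∃ m, u i = m + 1 := ⟨u i - 1, by omega⟩
    have := lt_two_pow_int (m + 1)
    rw [Function.comp_apply, hm]
    push_cast at this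
    exact h1 k m (by omega) (by omega)
  intro x hx
  rcases eq_or_ne x.2.1 ∞ with h | h
  · obtain ⟨i, j, t⟩ := x
    obtain rfl : j = ∞ := h
    induction i using OnePoint.rec with
    | coe k => exact h2 k t
    | infty =>
      exact isClosed_closure.mem_of_tendsto
        ((tendsto_coe_natCast_add 0).prodMk_nhds tendsto_const_nhds)
        (Eventually.of_forall fun k => h2 _ t)
  · obtain ⟨n, hn⟩ := OnePoint.ne_infty_iff_exists.1 h
    obtain ⟨ht, hr⟩ := hx n hn.symm
    obtain ⟨i, j, t⟩ := x
    obtain rfl : (n : OnePoint ℕ) = j := hn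
    obtain rfl : t = height n := ht
    change i ∈ rows n at hr
    cases n with
    | zero =>
      induction i using OnePoint.rec with
      | infty =>
        exact mem_closure_of_tendsto ((tendsto_coe_natCast_add 1).prodMk_nhds tendsto_const_nhds)
          (Eventually.of_forall h0)
      | coe k =>
        rw [coe_mem_rows_zero] at hr
        obtain ⟨m, hm⟩ := Int.eq_ofNat_of_zero_le (by omega : 0 ≤ k - 1)
        have hk : k = 1 + m := by omega
        subst hk
        exact subset_closure (h0 m)
    | succ n =>
      obtain ⟨k, rfl, hk1, hk2⟩ := hr
      exact subset_closure (h1 k n hk1 hk2)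

/-- The system of signed cycles on the model space. -/
noncomputable def system : SignedCycleSystem space where
  p := rowPoint 0 (1 : ℤ) one_mem_rows_zero
  ψ := shiftMap
  isOpen_p := isOpen_rowPoint _
  continuous_ψ := continuous_shiftMap
  injective_ψ := injective_shiftMap
  range_ψ := range_shiftMap
  ε := sign
  continuous_ε := continuous_sign
  ε_sq x := by unfold sign; split_ifs <;> norm_num
  ε_p k := by
    rw [iterate_shiftMap_zero]
    refine if_neg fun h => ?_
    have := OnePoint.coe_eq_coe.1 h
    omega
  l := rowPoint 0 ∞ infty_mem_rows_zero
  tendsto_p := by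
    simp only [iterate_shiftMap_zero]
    rw [tendsto_subtype_rng]
    exact (tendsto_coe_natCast_add 1).prodMk_nhds tendsto_const_nhds
  y j := rowPoint (j + 1) (-2 ^ (j + 1) : ℤ) (neg_two_pow_mem_rows j)
  isOpen_y _ := isOpen_rowPoint _
  period := period
  sign j := by
    have : ∀ m ∈ Finset.range (2 ^ (j + 2)),
        sign (shiftMap^[m] (rowPoint (j + 1) (-2 ^ (j + 1) : ℤ) (neg_two_pow_mem_rows j))) =
          if 2 ^ (j + 1) = m then -1 else 1 := by
      intro m hm
      rw [iterate_shiftMap_succ (Finset.mem_range.1 hm)]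
      have hiff : ((-2 ^ (j + 1) + m : ℤ) : OnePoint ℤ) = ((0 : ℤ) : OnePoint ℤ) ↔
          2 ^ (j + 1) = m := by
        rw [OnePoint.coe_eq_coe, neg_add_eq_zero]
        exact_mod_cast Iff.rfl
      split_ifs with hc
      · exact if_pos (hiff.2 hc)
      · exact if_neg fun h => hc (hiff.1 h)
    rw [Finset.prod_congr rfl this, Finset.prod_ite_eq, if_pos]
    exact Finset.mem_range.2 (Nat.pow_lt_pow_right one_lt_two (by omega))
  separated a b i j h := by
    have h1 := congrArg (fun x : space => x.1.2.1) h
    simp only [row_iterate] at h1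
    have h2 := OnePoint.coe_eq_coe.1 h1
    omega
  dense := dense_orbits

/-- A continuous injection of the model space into the plane. -/
noncomputable def toPlane (x : space) : ℝ × ℝ :=
  ((x.1.1.toRat : ℝ) + √2 * (x.1.2.1.toRat : ℝ), x.1.2.2)

theorem continuous_toPlane : Continuous toPlane := by
  have h1 : Continuous fun x : space => (x.1.1.toRat : ℝ) :=
    OnePoint.continuous_toRat.comp (by fun_prop : Continuous fun x : space => x.1.1)
  have h2 : Continuous fun x : space => (x.1.2.1.toRat : ℝ) :=
    OnePoint.continuous_toRat.comp (by fun_prop : Continuous fun x : space => x.1.2.1)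
  exact (h1.add (continuous_const.mul h2)).prodMk (by fun_prop)

theorem injective_toPlane : Function.Injective toPlane := by
  intro x z h
  have h1 : (x.1.1.toRat : ℝ) + √2 * (x.1.2.1.toRat : ℝ) =
      (z.1.1.toRat : ℝ) + √2 * (z.1.2.1.toRat : ℝ) := congrArg Prod.fst h
  have h2 : (x.1.2.2 : ℝ) = z.1.2.2 := congrArg Prod.snd h
  have h3 : x.1.2.1.toRat = z.1.2.1.toRat := by
    by_contra hne
    have hne' : ((x.1.2.1.toRat : ℝ) - (z.1.2.1.toRat : ℝ)) ≠ 0 :=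
      sub_ne_zero.2 fun h => hne (Rat.cast_injective h)
    refine irrational_sqrt_two
      ⟨(z.1.1.toRat - x.1.1.toRat) / (x.1.2.1.toRat - z.1.2.1.toRat), ?_⟩
    push_cast
    rw [div_eq_iff hne']
    linarith
  have h4 : x.1.1.toRat = z.1.1.toRat := by
    rw [h3, add_left_inj] at h1
    exact Rat.cast_injective h1
  exact Subtype.ext (Prod.ext (OnePoint.toRat_injective h4)
    (Prod.ext (OnePoint.toRat_injective h3) (Subtype.ext h2)))

section Components

variable {Z : Type*} [TopologicalSpace Z] (h : Z ≃ₜ space)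

/-- The parametrization of the intervals. -/
def fiber (i : OnePoint ℤ) (t : unitInterval) : Z := h.symm ⟨(i, ∞, t), mem_space_infty i t⟩

theorem continuous_fiber (i : OnePoint ℤ) : Continuous (fiber h i) :=
  h.symm.continuous.comp (by fun_prop)

theorem fiber_mem_connectedComponent (i : OnePoint ℤ) (s t : unitInterval) :
    fiber h i t ∈ connectedComponent (fiber h i s) :=
  (isPreconnected_range (continuous_fiber h i)).subset_connectedComponent ⟨s, rfl⟩ ⟨t, rfl⟩

theorem coords_eq {z z' : Z} (hz : z' ∈ connectedComponent z) :
    (h z').1.1 = (h z).1.1 ∧ (h z').1.2.1 = (h z).1.2.1 := by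
  have hc : Continuous fun z : Z => ((h z).1.1, (h z).1.2.1) := by
    have := h.continuous
    fun_prop
  have := (isPreconnected_connectedComponent.image _ hc.continuousOn).subsingleton
    (Set.mem_image_of_mem _ hz) (Set.mem_image_of_mem _ mem_connectedComponent)
  exact Prod.ext_iff.1 this

theorem infinite_connectedComponent_fiber (i : OnePoint ℤ) :
    (connectedComponent (fiber h i 0)).Infinite := by
  have : Infinite unitInterval := (Set.Icc_infinite one_pos).to_subtype
  refine (Set.infinite_range_of_injective (f := fiber h i) fun s t hst => ?_).mono ?_
  · have := congrArg Subtype.val (h.symm.injective hst)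
    exact congrArg (fun x : OnePoint ℤ × OnePoint ℕ × unitInterval => x.2.2) this
  · rintro _ ⟨t, rfl⟩
    exact fiber_mem_connectedComponent h i 0 t

theorem setOf_infinite_connectedComponent :
    {C : Set Z | (∃ z : Z, C = connectedComponent z) ∧ C.Infinite} =
      Set.range fun i => connectedComponent (fiber h i 0) := by
  ext C
  constructor
  · rintro ⟨⟨z, rfl⟩, hC⟩
    refine ⟨(h z).1.1, ?_⟩
    have hz : (h z).1.2.1 = ∞ := by
      by_contra hne
      obtain ⟨n, hn⟩ := OnePoint.ne_infty_iff_exists.1 hne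
      refine hC (Set.Subsingleton.finite fun a ha b hb => h.injective ?_)
      have ha' := coords_eq h ha
      have hb' := coords_eq h hb
      rw [eq_rowPoint (ha'.2.trans hn.symm), eq_rowPoint (hb'.2.trans hn.symm)]
      exact Subtype.ext (Prod.ext (ha'.1.trans hb'.1.symm) rfl)
    have hzf : z = fiber h (h z).1.1 (h z).1.2.2 := by
      rw [fiber, Homeomorph.eq_symm_apply]
      exact Subtype.ext (Prod.ext rfl (Prod.ext hz rfl))
    refine connectedComponent_eq ?_
    have := fiber_mem_connectedComponent h (h z).1.1 0 (h z).1.2.2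
    rwa [← hzf] at this
  · rintro ⟨i, rfl⟩
    exact ⟨⟨_, rfl⟩, infinite_connectedComponent_fiber h i⟩

theorem injective_connectedComponent_fiber :
    Function.Injective fun i => connectedComponent (fiber h i 0) := by
  intro i i' hi
  have h1 : fiber h i 0 ∈ connectedComponent (fiber h i' 0) := by
    have h2 : connectedComponent (fiber h i 0) = connectedComponent (fiber h i' 0) := hi
    rw [← h2]
    exact mem_connectedComponent
  simpa [fiber] using (coords_eq h h1).1

end Components

end RowModel

/-- There is a compact subset `X` of `ℝ²` having countably infinitely many infinite
connected components such that `C(X;𝕂)` admits an isometric shift of type I which is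
non-primitive and `∞`-generated (hence of type I₀), for `𝕂 = ℝ` or `ℂ`. -/
theorem stmt6 :
    ∃ (X : Set (ℝ × ℝ)) (_ : CompactSpace X),
      {C : Set X | (∃ z : X, C = connectedComponent z) ∧ C.Infinite}.Countable ∧
      {C : Set X | (∃ z : X, C = connectedComponent z) ∧ C.Infinite}.Infinite ∧
      ∀ (𝕂 : Type) [RCLike 𝕂],
        ∃ (T : C(X, 𝕂) →L[𝕂] C(X, 𝕂)) (w : TypeIWitness T),
          IsIsometricShift T ∧ w.NonPrimitive ∧ w.InftyGenerated ∧ ¬IsTypeII T := by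
  have hemb := RowModel.continuous_toPlane.isClosedEmbedding RowModel.injective_toPlane
  let h : RowModel.space ≃ₜ Set.range RowModel.toPlane := hemb.isEmbedding.toHomeomorph
  have hcpt : CompactSpace (Set.range RowModel.toPlane) := h.compactSpace
  refine ⟨Set.range RowModel.toPlane, hcpt, ?_, ?_, fun 𝕂 _ => ?_⟩
  · rw [RowModel.setOf_infinite_connectedComponent h.symm]
    have : Countable (OnePoint ℤ) := inferInstanceAs (Countable (Option ℤ))
    exact Set.countable_range _
  · rw [RowModel.setOf_infinite_connectedComponent h.symm]
    exact Set.infinite_range_of_injective (RowModel.injective_connectedComponent_fiber h.symm)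
  · let D := RowModel.system.map h
    exact ⟨D.shift, D.witness, D.isIsometricShift_shift, D.nonPrimitive_witness,
      D.inftyGenerated_witness, D.not_isTypeII_shift⟩
end

section
/- Let n ≥ 2 and for each i ∈ {1,…,n} let ι_i be a type of cardinality at most 𝔠. Let X be the topological sum 𝕋^{ι_1} ⊕ ⋯ ⊕ 𝕋^{ι_n} ⊕ OnePoint ℕ, where 𝕋^{ι_i} = (ι_i → 𝕋) carries the product topology (so X is compact Hausdorff). Then there exists an isometric shift T on C(X;ℂ) which is of type I, non-primitive, and n-generated. -/
open Topology

open Topology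

open MeasureTheory Measure in
/-- A criterion for density of the powers of `g` in a compact group: the continuous functions are
densely spanned by functions which are constant `1` or nontrivially twisted by translation by
`g`. -/
theorem denseRange_pow_of_dense_span {G : Type*} [Group G] [TopologicalSpace G]
    [IsTopologicalGroup G] [CompactSpace G] [T2Space G] (g : G) (S : Set C(G, ℂ))
    (hS : (Submodule.span ℂ S).topologicalClosure = ⊤)
    (h : ∀ χ ∈ S, χ = 1 ∨ ∃ z : ℂ, z ≠ 1 ∧ ∀ x, χ (g * x) = z * χ x) :
    DenseRange fun k : ℕ => g ^ k := by
  rw [← denseRange_zpow_iff_pow]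
  let H : Subgroup G := (Subgroup.zpowers g).topologicalClosure
  have hHc : IsClosed (H : Set G) := Subgroup.isClosed_topologicalClosure _
  have hgH : g ∈ H := Subgroup.le_topologicalClosure _ (Subgroup.mem_zpowers g)
  have : CompactSpace H := isCompact_iff_compactSpace.mp hHc.isCompact
  borelize G
  have : BorelSpace H := Subtype.borelSpace (H : Set G)
  let μ : Measure G := haarMeasure ⊤
  let ν : Measure H := haarMeasure ⊤
  have : IsProbabilityMeasure μ :=
    ⟨haarMeasure_self (K₀ := (⊤ : TopologicalSpace.PositiveCompacts G))⟩
  have : IsProbabilityMeasure ν :=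
    ⟨haarMeasure_self (K₀ := (⊤ : TopologicalSpace.PositiveCompacts H))⟩
  have intG (f : C(G, ℂ)) : Integrable f μ :=
    f.continuous.integrable_of_hasCompactSupport (HasCompactSupport.of_compactSpace _)
  have intH (f : C(G, ℂ)) : Integrable (fun x : H => f x) ν :=
    (f.continuous.comp continuous_subtype_val).integrable_of_hasCompactSupport
      (HasCompactSupport.of_compactSpace _)
  let D : C(G, ℂ) →ₗ[ℂ] ℂ :=
    { toFun := fun f => (∫ x, f x ∂μ) - ∫ x : H, f x ∂ν
      map_add' := fun f f' => by
        simp only [ContinuousMap.add_apply]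
        rw [integral_add (intG f) (intG f'), integral_add (intH f) (intH f')]
        ring
      map_smul' := fun c f => by
        simp only [ContinuousMap.smul_apply, integral_smul, RingHom.id_apply, smul_sub] }
  have hD : ∀ f, ‖D f‖ ≤ 2 * ‖f‖ := fun f => by
    have h1 : ‖∫ x, f x ∂μ‖ ≤ ‖f‖ := by
      simpa using norm_integral_le_of_norm_le_const (μ := μ) (f := f) (C := ‖f‖)
        (Filter.Eventually.of_forall f.norm_coe_le_norm)
    have h2 : ‖∫ x : H, f x ∂ν‖ ≤ ‖f‖ := by
      simpa using norm_integral_le_of_norm_le_const (μ := ν) (f := fun x : H => f x) (C := ‖f‖)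
        (Filter.Eventually.of_forall fun x => f.norm_coe_le_norm x)
    calc ‖D f‖ ≤ ‖∫ x, f x ∂μ‖ + ‖∫ x : H, f x ∂ν‖ := norm_sub_le _ _
      _ ≤ 2 * ‖f‖ := by linarith
  let Dc : C(G, ℂ) →L[ℂ] ℂ := D.mkContinuous 2 hD
  have hDS : S ⊆ LinearMap.ker (Dc : C(G, ℂ) →ₗ[ℂ] ℂ) := by
    intro χ hχ
    change (∫ x, χ x ∂μ) - ∫ x : H, χ x ∂ν = 0
    rcases h χ hχ with rfl | ⟨z, hz, hχz⟩
    · simp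
    · have e1 : ∫ x, χ x ∂μ = z * ∫ x, χ x ∂μ := by
        conv_lhs => rw [← integral_mul_left_eq_self (fun x => χ x) g]
        simp only [hχz, integral_const_mul]
      have e2 : ∫ x : H, χ x ∂ν = z * ∫ x : H, χ x ∂ν := by
        conv_lhs => rw [← integral_mul_left_eq_self (fun x : H => χ x) ⟨g, hgH⟩]
        simp only [Subgroup.coe_mul, hχz, integral_const_mul]
      have aux : ∀ w : ℂ, w = z * w → w = 0 := fun w hw => by
        have : (z - 1) * w = 0 := by linear_combination -hw
        exact (mul_eq_zero.mp this).resolve_left (sub_ne_zero.mpr hz)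
      rw [aux _ e1, aux _ e2, sub_zero]
  have hker : ∀ f, Dc f = 0 := by
    have hle : (Submodule.span ℂ S).topologicalClosure ≤
        LinearMap.ker (Dc : C(G, ℂ) →ₗ[ℂ] ℂ) :=
      Submodule.topologicalClosure_minimal _ (Submodule.span_le.mpr hDS)
        Dc.isClosed_ker
    intro f
    exact hle (hS ▸ Submodule.mem_top)
  have hH : (H : Set G) = Set.univ := by
    by_contra hne
    obtain ⟨x, hx⟩ := (Set.ne_univ_iff_exists_notMem _).mp hne
    obtain ⟨f, hf0, hf1, hf⟩ := exists_continuous_zero_one_of_isClosed hHc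
      (isClosed_singleton (x := x)) (Set.disjoint_singleton_right.mpr hx)
    have hpos : 0 < ∫ y, f y ∂μ :=
      f.continuous.integral_pos_of_hasCompactSupport_nonneg_nonzero
        (HasCompactSupport.of_compactSpace _) (fun y => (hf y).1) (x := x)
        (by rw [hf1 rfl]; exact one_ne_zero)
    have hz : (∫ y, (f y : ℂ) ∂μ) - ∫ y : H, (f y : ℂ) ∂ν = 0 :=
      hker ⟨fun y => (f y : ℂ), by fun_prop⟩
    have hz2 : ∫ y : H, (f y : ℂ) ∂ν = 0 := by
      rw [← integral_zero H ℂ]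
      congr 1
      ext y
      simp [hf0 y.2]
    rw [hz2, sub_zero, integral_complex_ofReal, Complex.ofReal_eq_zero] at hz
    exact hpos.ne' hz
  have hrange : (Set.range fun k : ℤ => g ^ k) = Subgroup.zpowers g := rfl
  rw [DenseRange, hrange, dense_iff_closure_eq, ← Subgroup.topologicalClosure_coe]
  exact hH

/-- **Kronecker's theorem**: the powers of a multiplicatively independent family are dense in the
torus. -/
theorem denseRange_pow_of_multiplicativelyIndependent {J : Type*} (g : J → Circle)
    (hg : ∀ m : J →₀ ℤ, (m.prod fun j k => g j ^ k) = 1 → m = 0) :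
    DenseRange fun k : ℕ => g ^ k := by
  let e : J → C(J → Circle, ℂ) := fun j => ⟨fun x => (x j : ℂ), by fun_prop⟩
  let A : StarSubalgebra ℂ C(J → Circle, ℂ) := StarAlgebra.adjoin ℂ (Set.range e)
  have hsep : A.SeparatesPoints := by
    intro x y hxy
    obtain ⟨j, hj⟩ := Function.ne_iff.mp hxy
    exact ⟨e j, ⟨e j, StarAlgebra.subset_adjoin _ _ ⟨j, rfl⟩, rfl⟩,
      fun h => hj (Circle.ext h)⟩
  have hA := ContinuousMap.starSubalgebra_topologicalClosure_eq_top_of_separatesPoints A hsep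
  refine denseRange_pow_of_dense_span g
    (Submonoid.closure (Set.range e ∪ star (Set.range e)) : Set C(J → Circle, ℂ)) ?_ ?_
  · rw [← Algebra.adjoin_eq_span]
    apply SetLike.coe_injective
    exact congrArg (fun B : StarSubalgebra ℂ C(J → Circle, ℂ) => (B : Set C(J → Circle, ℂ))) hA
  · intro χ hχ
    have key : ∃ m : J →₀ ℤ, ∀ x : J → Circle, χ x = (m.prod fun j k => x j ^ k : Circle) := by
      induction hχ using Submonoid.closure_induction with
      | mem f hf =>
        rcases hf with ⟨j, rfl⟩ | ⟨j, hj⟩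
        · exact ⟨Finsupp.single j 1, fun x => by simp [e]⟩
        · refine ⟨Finsupp.single j (-1), fun x => ?_⟩
          have : f = star (e j) := by rw [hj, star_star]
          rw [Finsupp.prod_single_index (zpow_zero _), zpow_neg_one, Circle.coe_inv_eq_conj, this]
          rfl
      | one => exact ⟨0, fun x => by simp⟩
      | mul f f' _ _ hf hf' =>
        obtain ⟨m, hm⟩ := hf
        obtain ⟨m', hm'⟩ := hf'
        classical
        refine ⟨m + m', fun x => ?_⟩
        rw [Finsupp.prod_add_index' (by simp) (fun j a b => zpow_add _ _ _)]
        simp [hm, hm']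
    obtain ⟨m, hm⟩ := key
    by_cases h1 : (m.prod fun j k => g j ^ k) = 1
    · left
      ext x
      rw [hm, hg m h1]
      simp
    · refine Or.inr ⟨_, fun h => h1 (Circle.ext h), fun x => ?_⟩
      rw [hm, hm, ← Circle.coe_mul]
      congr 1
      simp only [Pi.mul_apply, mul_zpow]
      exact Finsupp.prod_mul

/-- A torus of dimension at most the continuum is monothetic. -/
theorem exists_denseRange_pow_pi_circle {J : Type*}
    (hJ : Cardinal.mk J ≤ Cardinal.continuum) :
    ∃ g : J → Circle, DenseRange fun k : ℕ => g ^ k := by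
  let B := Module.Basis.ofVectorSpace ℚ ℝ
  have hB : Cardinal.lift.{0} (Cardinal.mk (Option J)) ≤
      Cardinal.lift (Cardinal.mk (Module.Basis.ofVectorSpaceIndex ℚ ℝ)) := by
    rw [B.mk_eq_rank'', Real.rank_rat_real, Cardinal.mk_option]
    simpa using Cardinal.add_le_of_le Cardinal.aleph0_le_continuum hJ
      (Cardinal.one_le_aleph0.trans Cardinal.aleph0_le_continuum)
  obtain ⟨f⟩ := Cardinal.lift_mk_le'.mp hB
  let θ : Option J → ℝ := fun j => B (f j)
  have hθ : LinearIndependent ℚ θ := B.linearIndependent.comp f f.injective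
  have h0 : θ none ≠ 0 := hθ.ne_zero none
  refine ⟨fun j => Circle.exp (2 * Real.pi * (θ (some j) / θ none)),
    denseRange_pow_of_multiplicativelyIndependent _ fun m hm => ?_⟩
  have e1 : Circle.exp (2 * Real.pi * ((m.sum fun j k => k * θ (some j)) / θ none)) = 1 := by
    rw [← hm, Finsupp.sum, Finset.sum_div, Finset.mul_sum]
    calc Circle.exp (∑ j ∈ m.support, 2 * Real.pi * (m j * θ (some j) / θ none))
        = ∏ j ∈ m.support, Circle.exp (2 * Real.pi * (m j * θ (some j) / θ none)) :=
          map_sum Circle.expHom _ _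
      _ = ∏ j ∈ m.support, Circle.exp (2 * Real.pi * (θ (some j) / θ none)) ^ m j :=
          Finset.prod_congr rfl fun j _ => by
            rw [← Circle.exp_zsmul, zsmul_eq_mul]
            congr 1
            ring
  obtain ⟨k, hk⟩ := Circle.exp_eq_one.mp e1
  have hk' : (m.sum fun j k => k * θ (some j)) = k * θ none := by
    rw [← div_eq_iff h0]
    refine mul_left_cancel₀ Real.two_pi_pos.ne' (hk.trans (mul_comm _ _))
  have hl := linearIndependent_iff.mp (hθ.restrict_scalars' ℤ)
    (m.embDomain Function.Embedding.some - Finsupp.single none k) (by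
      rw [map_sub, Finsupp.linearCombination_embDomain, Finsupp.linearCombination_single,
        Finsupp.linearCombination_apply, sub_eq_zero]
      simpa using hk')
  ext j
  have := DFunLike.congr_fun hl (some j)
  rw [Finsupp.sub_apply, Finsupp.single_eq_of_ne (by simp), sub_zero] at this
  exact (Finsupp.embDomain_apply_self Function.Embedding.some m j).symm.trans this

/-- A continuous function on a compact group which converges along the powers of a topological
generator is constant. -/
theorem eq_of_tendsto_of_denseRange_pow {G M : Type*} [Group G] [TopologicalSpace G]
    [ContinuousMul G] [TopologicalSpace M] [T3Space M] {g : G}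
    (hg : DenseRange fun k : ℕ => g ^ k) {F : G → M} (hF : Continuous F) {L : M}
    (hL : Filter.Tendsto (fun k : ℕ => F (g ^ (k + 1))) Filter.atTop (𝓝 L)) (x : G) :
    F x = L := by
  by_contra hne
  obtain ⟨V, hV, hVc, hVx⟩ := exists_mem_nhds_isClosed_subset
    (isOpen_compl_singleton.mem_nhds (Ne.symm hne : L ∈ ({F x}ᶜ : Set M)))
  obtain ⟨N, hN⟩ := Filter.eventually_atTop.mp (hL hV)
  have hd : DenseRange fun k : ℕ => g ^ (N + 1) * g ^ k :=
    (Homeomorph.mulLeft (g ^ (N + 1))).surjective.denseRange.comp hg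
      (Homeomorph.mulLeft (g ^ (N + 1))).continuous
  have hsub : (Set.range fun k : ℕ => g ^ (N + 1) * g ^ k) ⊆ F ⁻¹' V := by
    rintro _ ⟨k, rfl⟩
    have h : g ^ (N + 1) * g ^ k = g ^ (N + k + 1) := by rw [← pow_add, Nat.add_right_comm]
    exact (congrArg (F · ∈ V) h).mpr (hN (N + k) (Nat.le_add_right _ _))
  exact hVx ((hVc.preimage hF).closure_subset_iff.mpr hsub (hd x)) rfl

section WeightedShift

variable {X : Type*} [TopologicalSpace X] [CompactSpace X]

/-- The data of a homeomorphism `σ : X∖{p} → X` with inverse `τ`, where `p` is isolated, a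
unimodular weight, and a contractive functional prescribing the value at `p`. -/
structure ShiftData (X : Type*) [TopologicalSpace X] [CompactSpace X] where
  /-- The isolated point. -/
  p : X
  isClopen_p : IsClopen ({p} : Set X)
  /-- The homeomorphism, extended to `p`. -/
  σ : C(X, X)
  /-- The inverse of the homeomorphism. -/
  τ : C(X, X)
  σ_τ : ∀ x, σ (τ x) = x
  τ_σ : ∀ x, x ≠ p → τ (σ x) = x
  τ_ne : ∀ x, τ x ≠ p
  /-- The weight. -/
  a : C(X, ℂ)
  norm_a : ∀ x, ‖a x‖ = 1
  /-- The value at the isolated point. -/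
  Δ : C(X, ℂ) →ₗ[ℂ] ℂ
  norm_Δ : ∀ f, ‖Δ f‖ ≤ ‖f‖

namespace ShiftData

variable (d : ShiftData X)

/-- The indicator function of the isolated point. -/
noncomputable def bump : C(X, ℂ) :=
  ⟨({d.p} : Set X).indicator fun _ => 1, d.isClopen_p.continuous_indicator continuous_const⟩

theorem bump_p : d.bump d.p = 1 := by simp [bump]

theorem bump_of_ne {x : X} (hx : x ≠ d.p) : d.bump x = 0 := by simp [bump, hx]

/-- The weighted shift as a linear map. -/
noncomputable def linearMap : C(X, ℂ) →ₗ[ℂ] C(X, ℂ) where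
  toFun f := d.Δ f • d.bump + (1 - d.bump) * (d.a * f.comp d.σ)
  map_add' f g := by
    ext x
    simp
    ring
  map_smul' c f := by
    ext x
    simp
    ring

theorem linearMap_p (f : C(X, ℂ)) : d.linearMap f d.p = d.Δ f := by
  simp [linearMap, bump_p]

theorem linearMap_of_ne (f : C(X, ℂ)) {x : X} (hx : x ≠ d.p) :
    d.linearMap f x = d.a x * f (d.σ x) := by
  simp [linearMap, d.bump_of_ne hx]

theorem linearMap_τ (f : C(X, ℂ)) (x : X) : d.linearMap f (d.τ x) = d.a (d.τ x) * f x := by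
  rw [d.linearMap_of_ne f (d.τ_ne x), d.σ_τ]

theorem norm_linearMap (f : C(X, ℂ)) : ‖d.linearMap f‖ = ‖f‖ := by
  apply le_antisymm
  · refine (ContinuousMap.norm_le _ (norm_nonneg _)).mpr fun x => ?_
    by_cases hx : x = d.p
    · rw [hx, linearMap_p]
      exact d.norm_Δ f
    · rw [d.linearMap_of_ne f hx, norm_mul, d.norm_a, one_mul]
      exact f.norm_coe_le_norm _
  · refine (ContinuousMap.norm_le _ (norm_nonneg _)).mpr fun x => ?_
    have := (d.linearMap f).norm_coe_le_norm (d.τ x)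
    rwa [linearMap_τ, norm_mul, d.norm_a, one_mul] at this

/-- The weighted shift. -/
noncomputable def shift : C(X, ℂ) →L[ℂ] C(X, ℂ) :=
  LinearIsometry.toContinuousLinearMap ⟨d.linearMap, d.norm_linearMap⟩

theorem shift_apply (f : C(X, ℂ)) : d.shift f = d.linearMap f := rfl

theorem a_ne_zero (x : X) : d.a x ≠ 0 := norm_ne_zero_iff.mp (by simp [d.norm_a])

/-- The left inverse of the weighted shift. -/
noncomputable def leftInverse : C(X, ℂ) →ₗ[ℂ] C(X, ℂ) where
  toFun f := ⟨fun x => (d.a (d.τ x))⁻¹ * f (d.τ x),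
    ((d.a.comp d.τ).continuous.inv₀ fun x => d.a_ne_zero (d.τ x)).mul (f.comp d.τ).continuous⟩
  map_add' f g := by
    ext x
    simp
    ring
  map_smul' c f := by
    ext x
    simp
    ring

theorem leftInverse_apply (f : C(X, ℂ)) (x : X) :
    d.leftInverse f x = (d.a (d.τ x))⁻¹ * f (d.τ x) := rfl

theorem leftInverse_linearMap (f : C(X, ℂ)) : d.leftInverse (d.linearMap f) = f := by
  ext x
  rw [leftInverse_apply, linearMap_τ, inv_mul_cancel_left₀ (d.a_ne_zero _)]

/-- The functional whose kernel is the range of the weighted shift. -/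
noncomputable def cokernelMap : C(X, ℂ) →ₗ[ℂ] ℂ where
  toFun f := f d.p - d.Δ (d.leftInverse f)
  map_add' f g := by
    simp
    ring
  map_smul' c f := by
    simp
    ring

theorem cokernelMap_apply (f : C(X, ℂ)) :
    d.cokernelMap f = f d.p - d.Δ (d.leftInverse f) := rfl

theorem ker_cokernelMap : LinearMap.ker d.cokernelMap = LinearMap.range d.linearMap := by
  ext f
  rw [LinearMap.mem_ker, cokernelMap_apply, sub_eq_zero]
  constructor
  · intro h
    refine ⟨d.leftInverse f, ?_⟩
    ext x
    by_cases hx : x = d.p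
    · rw [hx, linearMap_p, h]
    · rw [d.linearMap_of_ne _ hx, leftInverse_apply, d.τ_σ x hx,
        mul_inv_cancel_left₀ (d.a_ne_zero x)]
  · rintro ⟨g, rfl⟩
    rw [leftInverse_linearMap, linearMap_p]

theorem cokernelMap_surjective : Function.Surjective d.cokernelMap := by
  intro c
  refine ⟨c • d.bump, ?_⟩
  have h : d.leftInverse d.bump = 0 := by
    ext x
    rw [leftInverse_apply, d.bump_of_ne (d.τ_ne x), mul_zero, ContinuousMap.zero_apply]
  rw [map_smul, cokernelMap_apply, h, map_zero, bump_p, sub_zero, smul_eq_mul, mul_one]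

theorem rank_quotient_range_shift :
    Module.rank ℂ (C(X, ℂ) ⧸ LinearMap.range (d.shift : C(X, ℂ) →ₗ[ℂ] C(X, ℂ))) = 1 := by
  change Module.rank ℂ (C(X, ℂ) ⧸ LinearMap.range d.linearMap) = 1
  rw [← d.ker_cokernelMap]
  simpa using (LinearMap.quotKerEquivOfSurjective _ d.cokernelMap_surjective).lift_rank_eq

/-- The homeomorphism underlying the weighted shift. -/
def homeomorph : {x : X // x ≠ d.p} ≃ₜ X where
  toFun x := d.σ x
  invFun x := ⟨d.τ x, d.τ_ne x⟩
  left_inv x := Subtype.ext (d.τ_σ x x.2)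
  right_inv x := d.σ_τ x
  continuous_toFun := d.σ.continuous.comp continuous_subtype_val
  continuous_invFun := d.τ.continuous.subtype_mk _

/-- The weighted shift is of type I. -/
noncomputable def witness : TypeIWitness d.shift where
  p := d.p
  isolated := d.isClopen_p.isOpen
  φ := d.homeomorph
  a := d.a.comp ⟨Subtype.val, continuous_subtype_val⟩
  norm_a x := d.norm_a x
  hT f x := d.linearMap_of_ne f x.2

theorem nseq_witness (k : ℕ) : d.witness.nseq k = d.τ^[k] d.p := by
  induction k with
  | zero => rfl
  | succ k ih =>
    rw [Function.iterate_succ_apply', ← ih]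
    rfl

theorem fwd_witness {x : X} (hx : x ≠ d.p) : d.witness.fwd x = d.σ x :=
  dif_neg hx

/-- Iterates of the shift at points along whose `τ`-orbit the weight is constant. -/
theorem shift_iterate_τ (f : C(X, ℂ)) (x : X) {c : ℂ} (hc : ∀ k : ℕ, d.a (d.τ^[k + 1] x) = c)
    (k : ℕ) : d.shift^[k] f (d.τ^[k] x) = c ^ k * f x := by
  induction k with
  | zero => simp
  | succ k ih =>
    have := hc k
    rw [Function.iterate_succ_apply'] at this
    rw [Function.iterate_succ_apply', Function.iterate_succ_apply', shift_apply, linearMap_τ, ih,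
      this]
    ring

end ShiftData

end WeightedShift

namespace TorusShift

variable {n : ℕ} {ι : Fin n → Type}

/-- The disjoint union of tori and a convergent sequence. -/
abbrev Space (ι : Fin n → Type) : Type := (Σ i : Fin n, (ι i → Circle)) ⊕ OnePoint ℕ

/-- Rotation of each torus, together with a self-map of the convergent sequence. -/
noncomputable def rotation (c : ∀ i, ι i → Circle) (s : ℕ → ℕ) (hs : Filter.Tendsto s .atTop .atTop) :
    C(Space ι, Space ι) where
  toFun := Sum.map (Sigma.map id fun i x => c i * x) (OnePoint.map s)
  continuous_toFun := by
    refine Continuous.sumMap ?_ (OnePoint.continuous_map continuous_of_discreteTopology ?_)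
    · exact Continuous.sigma_map fun i => continuous_const.mul continuous_id
    · rwa [Filter.coclosedCompact_eq_cocompact, Filter.cocompact_eq_cofinite,
        Nat.cofinite_eq_atTop]

/-- A weight that is constant on each torus, and equal to `1` on the convergent sequence. -/
def weight (l : Fin n → Circle) : C(Space ι, ℂ) where
  toFun := Sum.elim (fun x => (l x.1 : ℂ)) fun _ => 1
  continuous_toFun := Continuous.sumElim (continuous_sigma fun i => continuous_const (y := (l i : ℂ)))
    continuous_const

/-- The average of the values at the neutral elements of the tori. -/
noncomputable def average (ι : Fin n → Type) : C(Space ι, ℂ) →ₗ[ℂ] ℂ where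
  toFun f := ∑ i, (n : ℂ)⁻¹ * f (.inl ⟨i, 1⟩)
  map_add' f g := by simp [mul_add, Finset.sum_add_distrib]
  map_smul' c f := by simp [Finset.mul_sum, mul_left_comm]

theorem average_apply (f : C(Space ι, ℂ)) :
    average ι f = ∑ i, (n : ℂ)⁻¹ * f (.inl ⟨i, 1⟩) := rfl

theorem norm_average_le (f : C(Space ι, ℂ)) : ‖average ι f‖ ≤ ‖f‖ := by
  rw [average_apply, ← Finset.mul_sum, norm_mul, norm_inv, Complex.norm_natCast]
  have h : ‖∑ i : Fin n, f (.inl ⟨i, 1⟩)‖ ≤ n * ‖f‖ := by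
    simpa using norm_sum_le_of_le (f := fun i : Fin n => f (.inl ⟨i, 1⟩)) Finset.univ
      fun i _ => f.norm_coe_le_norm _
  rcases Nat.eq_zero_or_pos n with hn | hn
  · simp [hn]
  · rw [inv_mul_le_iff₀ (by exact_mod_cast hn)]
    exact h

/-- The shift data of a rotation on the tori, weighted by `l`, and the backward shift on the
convergent sequence. -/
noncomputable def data (c : ∀ i, ι i → Circle) (l : Fin n → Circle) : ShiftData (Space ι) where
  p := .inr ((0 : ℕ) : OnePoint ℕ)
  isClopen_p := ⟨isClosed_singleton, by
    rw [← Set.image_singleton, ← Set.image_singleton]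
    exact isOpenMap_inr _ (OnePoint.isOpenEmbedding_coe.isOpenMap _ (isOpen_discrete _))⟩
  σ := rotation (fun i => (c i)⁻¹) (· - 1) (Filter.tendsto_sub_atTop_nat 1)
  τ := rotation c (· + 1) (Filter.tendsto_add_atTop_nat 1)
  σ_τ := by
    rintro (⟨i, x⟩ | x)
    · simp [rotation, Sigma.map]
    · induction x using OnePoint.rec <;> simp [rotation]
  τ_σ := by
    rintro (⟨i, x⟩ | x) hx
    · simp [rotation, Sigma.map]
    · induction x using OnePoint.rec with
      | infty => simp [rotation]
      | coe k =>
        have : k ≠ 0 := fun h => hx (by rw [h])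
        simp [rotation, Nat.sub_add_cancel (Nat.pos_of_ne_zero this)]
  τ_ne := by
    rintro (⟨i, x⟩ | x)
    · simp [rotation]
    · induction x using OnePoint.rec with
      | infty => simp [rotation]
      | coe k =>
        intro h
        exact Nat.succ_ne_zero k (OnePoint.coe_injective (Sum.inr_injective h))
  a := weight fun i => (l i)⁻¹
  norm_a := by
    rintro (x | x)
    · exact Circle.norm_coe _
    · exact norm_one
  Δ := average ι
  norm_Δ := norm_average_le

section

variable (c : ∀ i, ι i → Circle) (l : Fin n → Circle)

theorem τ_iterate_inl (i : Fin n) (x : ι i → Circle) (k : ℕ) :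
    (data c l).τ^[k] (.inl ⟨i, x⟩) = .inl ⟨i, c i ^ k * x⟩ := by
  induction k with
  | zero => simp
  | succ k ih =>
    rw [Function.iterate_succ_apply', ih, pow_succ', mul_assoc]
    rfl

theorem τ_iterate_p (k : ℕ) :
    (data c l).τ^[k] (data c l).p = .inr (k : OnePoint ℕ) := by
  induction k with
  | zero => rfl
  | succ k ih =>
    rw [Function.iterate_succ_apply', ih]
    rfl

/-- The values on the convergent sequence of a function in the range of all powers of the shift
are determined by its values on the tori. -/
theorem apply_natCast_of_mem_iInter {f : C(Space ι, ℂ)}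
    (hf : f ∈ ⋂ k : ℕ, Set.range ((data c l).shift^[k + 1])) (k : ℕ) :
    f (.inr (k : OnePoint ℕ)) =
      ∑ i, (n : ℂ)⁻¹ * ((l i : ℂ) ^ (k + 1) * f (.inl ⟨i, c i ^ (k + 1)⟩)) := by
  obtain ⟨g, rfl⟩ := Set.mem_iInter.mp hf k
  have h1 := (data c l).shift_iterate_τ ((data c l).shift g) (data c l).p (c := 1)
    (fun j => by rw [τ_iterate_p]; rfl) k
  rw [τ_iterate_p, one_pow, one_mul, ← Function.iterate_succ_apply, ShiftData.shift_apply,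
    ShiftData.linearMap_p] at h1
  refine h1.trans ((average_apply g).trans (Finset.sum_congr rfl fun i _ => ?_))
  have h2 := (data c l).shift_iterate_τ g (.inl ⟨i, 1⟩) (c := ((l i)⁻¹ : Circle))
    (fun j => by rw [τ_iterate_inl]; rfl) (k + 1)
  rw [τ_iterate_inl, mul_one] at h2
  rw [h2, Circle.coe_inv, inv_pow, mul_inv_cancel_left₀ (pow_ne_zero _ (Circle.coe_ne_zero _))]

theorem iInter_range_shift (hn : n ≠ 0)
    (h : DenseRange fun k : ℕ =>
      (fun s : Σ i, Option (ι i) => s.2.elim (l s.1) (c s.1)) ^ k) :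
    (⋂ k : ℕ, Set.range ((data c l).shift^[k + 1])) = {0} := by
  refine Set.Subset.antisymm (fun f hf => ?_) ?_
  swap
  · rintro _ rfl
    exact Set.mem_iInter.mpr fun k => ⟨0, Function.iterate_fixed (map_zero _) _⟩
  have hn' : (n : ℂ)⁻¹ ≠ 0 := inv_ne_zero (Nat.cast_ne_zero.mpr hn)
  let F : ((Σ i, Option (ι i)) → Circle) → ℂ := fun z =>
    ∑ i, (n : ℂ)⁻¹ * ((z ⟨i, none⟩ : ℂ) * f (.inl ⟨i, fun j => z ⟨i, some j⟩⟩))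
  have hF : Continuous F := by
    refine continuous_finsetSum _ fun i _ => continuous_const.mul (Continuous.mul (by fun_prop) ?_)
    refine f.continuous.comp (continuous_inl.comp (continuous_sigmaMk.comp ?_))
    fun_prop
  have hFk (k : ℕ) : F ((fun s : Σ i, Option (ι i) => s.2.elim (l s.1) (c s.1)) ^ (k + 1)) =
      f (.inr (k : OnePoint ℕ)) :=
    (Finset.sum_congr rfl fun i _ => rfl).trans
      (apply_natCast_of_mem_iInter c l hf k).symm
  have hlim : Filter.Tendsto (fun k : ℕ => f (.inr (k : OnePoint ℕ))) Filter.atTop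
      (𝓝 (f (.inr OnePoint.infty))) := by
    refine ((f.continuous.comp continuous_inr).tendsto _).comp ?_
    rw [← Nat.cofinite_eq_atTop, ← Filter.cocompact_eq_cofinite,
      ← Filter.coclosedCompact_eq_cocompact]
    exact OnePoint.tendsto_coe_infty
  have hconst := eq_of_tendsto_of_denseRange_pow h hF (by simpa only [hFk] using hlim)
  have hinl (i : Fin n) (x : ι i → Circle) : f (.inl ⟨i, x⟩) = 0 := by
    let z : Circle → (Σ i, Option (ι i)) → Circle := fun w s =>
      Function.update (fun (j : Fin n) (_ : Option (ι j)) => (1 : Circle)) i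
        (fun o => o.elim w x) s.1 s.2
    have hz : F (z 1) - F (z (Circle.exp Real.pi)) = 0 := by rw [hconst, hconst, sub_self]
    simp only [F] at hz
    rw [← Finset.sum_sub_distrib, Finset.sum_eq_single i] at hz
    · simp only [z, Function.update_self, Option.elim, Circle.coe_one, Circle.coe_exp,
        Complex.exp_pi_mul_I] at hz
      rw [← mul_sub] at hz
      have := (mul_eq_zero.mp hz).resolve_left hn'
      linear_combination this / 2
    · intro j _ hj
      simp [z, Function.update_of_ne hj]
    · simp
  have hF0 (z) : F z = 0 := Finset.sum_eq_zero fun i _ => by rw [hinl, mul_zero, mul_zero]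
  rw [Set.mem_singleton_iff]
  ext x
  rcases x with ⟨i, x⟩ | x
  · exact hinl i x
  · induction x using OnePoint.rec with
    | infty => exact (hconst 1).symm.trans (hF0 1)
    | coe k => exact (hFk k).symm.trans (hF0 _)

theorem closure_NSet : closure (data c l).witness.NSet = Set.range Sum.inr := by
  have h : (data c l).witness.NSet = Sum.inr '' Set.range ((↑) : ℕ → OnePoint ℕ) := by
    rw [← Set.range_comp]
    refine congrArg Set.range (funext fun k => ?_)
    rw [ShiftData.nseq_witness, τ_iterate_p]
    rfl
  rw [h, IsClosedEmbedding.inr.isClosedMap.closure_image_eq_of_continuous continuous_inr, OnePoint.denseRange_coe.closure_range,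
    Set.image_univ]

theorem generatedBy (h : ∀ i, DenseRange fun k : ℕ => c i ^ k) :
    (data c l).witness.GeneratedBy n := by
  refine ⟨fun i => .inl ⟨i, 1⟩, fun i => by simp [closure_NSet], ?_⟩
  rw [closure_NSet]
  rintro (⟨i, x⟩ | x) hx
  · refine map_mem_closure (f := fun y : ι i → Circle => (Sum.inl ⟨i, y⟩ : Space ι))
      (continuous_inl.comp continuous_sigmaMk) (h i x) ?_
    rintro _ ⟨k, rfl⟩
    refine Set.mem_iUnion.mpr ⟨i, Or.inr ⟨k, ?_⟩⟩
    exact (τ_iterate_inl c l i 1 k).trans (by rw [mul_one])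
  · exact absurd ⟨x, rfl⟩ hx

/-- The index of the torus containing a point, if any. -/
def component : Space ι → Option (Fin n) := Sum.elim (fun x => some x.1) fun _ => none

theorem component_fwd (x : Space ι) : component ((data c l).witness.fwd x) = component x := by
  by_cases hx : x = (data c l).p
  · rw [show (data c l).witness.fwd x = (data c l).p from dif_pos hx, hx]
  · rw [ShiftData.fwd_witness _ hx]
    rcases x with x | x <;> rfl

theorem component_bwd (x : Space ι) : component ((data c l).witness.bwd x) = component x := by
  rcases x with x | x <;> rfl

theorem component_eq_of_mem_orbit {x y : Space ι} (hy : y ∈ (data c l).witness.orbit x) :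
    component y = component x := by
  have key (s : Space ι → Space ι) (hs : ∀ z, component (s z) = component z) (k : ℕ) :
      component (s^[k] x) = component x := by
    induction k with
    | zero => rfl
    | succ k ih => rw [Function.iterate_succ_apply', hs, ih]
  rcases hy with ⟨k, rfl⟩ | ⟨k, rfl⟩
  · exact key _ (component_fwd c l) k
  · exact key _ (component_bwd c l) k

theorem not_generatedBy {m : ℕ} (hm : m < n) : ¬(data c l).witness.GeneratedBy m := by
  rintro ⟨x, -, hx⟩
  have hsurj : ∀ i : Fin n, ∃ j, component (x j) = some i := by
    intro i
    have hmem : (.inl ⟨i, 1⟩ : Space ι) ∈ closure (⋃ j, (data c l).witness.orbit (x j)) :=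
      hx (by simp [closure_NSet])
    obtain ⟨_, ⟨y, rfl⟩, hy⟩ := mem_closure_iff.mp hmem
      (Set.range fun y : ι i → Circle => (Sum.inl ⟨i, y⟩ : Space ι))
      (IsOpenEmbedding.inl.comp IsOpenEmbedding.sigmaMk).isOpen_range ⟨1, rfl⟩
    obtain ⟨j, hj⟩ := Set.mem_iUnion.mp hy
    exact ⟨j, (component_eq_of_mem_orbit c l hj).symm⟩
  choose j hj using hsurj
  have hinj : Function.Injective j := fun i i' h => by
    simpa [hj] using congrArg (fun s => component (x s)) h
  exact hm.not_ge (by simpa using Fintype.card_le_of_injective j hinj)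

end

end TorusShift

/-- For `n ≥ 2` and types `ι i` of cardinality at most `𝔠`, the space
`C(𝕋^{ι 1} ⊕ ⋯ ⊕ 𝕋^{ι n} ⊕ OnePoint ℕ, ℂ)` admits an isometric shift of type I which is
non-primitive and `n`-generated. -/
theorem stmt7 (n : ℕ) (hn : 2 ≤ n) (ι : Fin n → Type)
    (hι : ∀ i, Cardinal.mk (ι i) ≤ Cardinal.continuum) :
    ∃ (T : C((Σ i : Fin n, (ι i → Circle)) ⊕ OnePoint ℕ, ℂ) →L[ℂ]
          C((Σ i : Fin n, (ι i → Circle)) ⊕ OnePoint ℕ, ℂ))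
      (w : TypeIWitness T),
      IsIsometricShift T ∧ w.NonPrimitive ∧ w.IsNGenerated n := by
  have hJ : Cardinal.mk (Σ i, Option (ι i)) ≤ Cardinal.continuum := by
    rw [Cardinal.mk_sigma]
    refine (Cardinal.sum_le_sum _ (fun _ => Cardinal.continuum) fun i => ?_).trans ?_
    · rw [Cardinal.mk_option]
      exact Cardinal.add_le_of_le Cardinal.aleph0_le_continuum (hι i)
        (Cardinal.one_le_aleph0.trans Cardinal.aleph0_le_continuum)
    · simp only [Cardinal.sum_const, Cardinal.lift_id, Cardinal.mk_fin]
      exact Cardinal.mul_le_of_le Cardinal.aleph0_le_continuum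
        ((Cardinal.natCast_lt_aleph0 (n := n)).le.trans Cardinal.aleph0_le_continuum) le_rfl
  obtain ⟨g, hg⟩ := exists_denseRange_pow_pi_circle hJ
  let c : ∀ i, ι i → Circle := fun i j => g ⟨i, some j⟩
  let l : Fin n → Circle := fun i => g ⟨i, none⟩
  have hgcl : (fun s : Σ i, Option (ι i) => s.2.elim (l s.1) (c s.1)) = g := by
    ext ⟨i, _ | j⟩ <;> rfl
  have hc (i : Fin n) : DenseRange fun k : ℕ => c i ^ k := by
    have hs : Function.Surjective
        fun (z : (Σ i, Option (ι i)) → Circle) (j : ι i) => z ⟨i, some j⟩ := by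
      intro x
      refine ⟨fun s => Function.update (fun (j : Fin n) (_ : Option (ι j)) => (1 : Circle)) i
        (fun o => o.elim 1 x) s.1 s.2, ?_⟩
      simp
    exact hs.denseRange.comp hg (by fun_prop)
  refine ⟨(TorusShift.data c l).shift, (TorusShift.data c l).witness,
    ⟨(TorusShift.data c l).norm_linearMap, (TorusShift.data c l).rank_quotient_range_shift,
      TorusShift.iInter_range_shift c l (by lia) (by rwa [hgcl])⟩, ?_,
    TorusShift.generatedBy c l hc, fun m hm => TorusShift.not_generatedBy c l hm⟩
  rw [TypeIWitness.NonPrimitive, TorusShift.closure_NSet]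
  intro h
  have : (.inl ⟨⟨0, by lia⟩, 1⟩ : TorusShift.Space ι) ∈ Set.range Sum.inr := h ▸ Set.mem_univ _
  simp at this
end
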